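/- arXiv:1501.03394 — 2 statements merged into one kernel-verified Lean document; each statement's English description precedes it below -/
import Mathlib

section
/- For n ≥ 4, −1 < α < 1 and β > 0, the zeros of φ_n^{(α,β)} and φ_{n−1}^{(α,β)} are negative and interlacing, where φ_m^{(α,β)}(μ) := Σ_{k=0}^{[m/2]} [(d/dx)^{2k} P_m^{(α,β)}(x)]|_{x=1} · μ^k. -/
open Polynomial

/-- The Jacobi polynomial `P_n^{(α,β)}` as a real polynomial in `x`. -/
noncomputable def jacobiP (α β : ℝ) (n : ℕ) : Polynomial ℝ :=
  C ((ascPochhammer ℝ n).eval (α + 1) / (n.factorial : ℝ)) *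
    ∑ k ∈ Finset.range (n + 1),
      C ((ascPochhammer ℝ k).eval (-(n : ℝ)) * (ascPochhammer ℝ k).eval ((n : ℝ) + α + β + 1) /
          ((k.factorial : ℝ) * (ascPochhammer ℝ k).eval (α + 1))) *
        (C (1 / 2 : ℝ) * (1 - X)) ^ k

/-- `φ_n^{(α,β)}(μ) = Σ_{k=0}^{[n/2]} (d/dx)^{2k} P_n^{(α,β)}(x)|_{x=1} · μ^k`. -/
noncomputable def phi (α β : ℝ) (n : ℕ) : Polynomial ℝ :=
  ∑ k ∈ Finset.range (n / 2 + 1),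
    C ((Polynomial.derivative^[2 * k] (jacobiP α β n)).eval 1) * X ^ k

/-- All complex zeros of `p` are real (i.e. `p` splits over `ℝ`). -/
def RealRooted (p : Polynomial ℝ) : Prop := (p.roots.card : ℕ) = p.natDegree

/-- All zeros of `p` are real and simple. -/
def AllRealSimple (p : Polynomial ℝ) : Prop := RealRooted p ∧ p.roots.Nodup

/-- Zeros of `g` and `h` interlace strictly. -/
def StrictlyInterlacing (g h : Polynomial ℝ) : Prop :=
  AllRealSimple g ∧ AllRealSimple h ∧
  (∀ x : ℝ, ¬(g.IsRoot x ∧ h.IsRoot x)) ∧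
  (∀ x y : ℝ, g.IsRoot x → g.IsRoot y → x < y →
      (∀ t : ℝ, g.IsRoot t → ¬(x < t ∧ t < y)) →
      ∃! z : ℝ, h.IsRoot z ∧ x < z ∧ z < y) ∧
  (∀ x y : ℝ, h.IsRoot x → h.IsRoot y → x < y →
      (∀ t : ℝ, h.IsRoot t → ¬(x < t ∧ t < y)) →
      ∃! z : ℝ, g.IsRoot z ∧ x < z ∧ z < y)

/-- `(g,h)` is a real pair: every real combination has only real zeros.
This is equivalent to non-strict interlacing of the zeros. -/
def RealPair (g h : Polynomial ℝ) : Prop :=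
  ∀ a b : ℝ, RealRooted (C a * g + C b * h)

/-- The zero of `p` closest to the origin, when all zeros of `p` are negative. -/
noncomputable def maxRoot (p : Polynomial ℝ) : ℝ := sSup {x : ℝ | p.IsRoot x}

/-- `f` is Hurwitz stable: all complex zeros lie in the open left half-plane. -/
def HurwitzStable (f : Polynomial ℝ) : Prop :=
  ∀ z : ℂ, Polynomial.aeval z f = 0 → z.re < 0



lemma wt_int {α β : ℝ} (hα : -1 < α) (hβ : -1 < β) :
    IntervalIntegrable (fun t : ℝ => t ^ α * (1 - t) ^ β) MeasureTheory.volume 0 1 := by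
  have left : ∀ {a b : ℝ}, -1 < a →
      IntervalIntegrable (fun t : ℝ => t ^ a * (1 - t) ^ b) MeasureTheory.volume 0 (1/2) := by
    intro a b ha
    refine (intervalIntegral.intervalIntegrable_rpow' ha).mul_continuousOn ?_
    intro t ht
    rw [Set.uIcc_of_le (by norm_num)] at ht
    apply ContinuousAt.continuousWithinAt
    apply ContinuousAt.rpow_const
    · fun_prop
    · left; have := ht.2; intro h; linarith
  refine (left hα).trans ?_
  have h := ((left (a := β) (b := α) hβ).comp_sub_left 1).symm
  norm_num at h
  refine h.congr ?_
  intro t _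
  simp [mul_comm]

lemma wtp_int {α β : ℝ} (hα : -1 < α) (hβ : -1 < β) (p : ℝ[X]) :
    IntervalIntegrable (fun t : ℝ => p.eval t * (t ^ α * (1 - t) ^ β)) MeasureTheory.volume 0 1 :=
  (wt_int hα hβ).continuousOn_mul p.continuous.continuousOn

lemma exists_functional {α β : ℝ} (hα : -1 < α) (hβ : -1 < β) :
    ∃ L : ℝ[X] →ₗ[ℝ] ℝ,
      (∀ p : ℝ[X], p ≠ 0 → (∀ t : ℝ, 0 < t → t < 1 → 0 ≤ p.eval t) → 0 < L p) ∧
      (∀ p : ℝ[X], L (X * (1 - X) * derivative p) +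
        L ((C (α + 1) - C (α + β + 2) * X) * p) = 0) := by
  refine ⟨{ toFun := fun p => ∫ t in (0:ℝ)..1, p.eval t * (t ^ α * (1 - t) ^ β)
            map_add' := ?_
            map_smul' := ?_ }, ?_, ?_⟩
  · intro p q
    rw [← intervalIntegral.integral_add (wtp_int hα hβ p) (wtp_int hα hβ q)]
    congr 1; ext t; simp; ring
  · intro c p
    simp only [eval_smul, smul_eq_mul, RingHom.id_apply, mul_assoc]
    rw [intervalIntegral.integral_const_mul]
  · intro p hp0 hp
    simp only [LinearMap.coe_mk, AddHom.coe_mk]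
    have h0 : ∀ᵐ t ∂(MeasureTheory.volume.restrict (Set.uIoc (0:ℝ) 1)),
        (0 : ℝ → ℝ) t ≤ p.eval t * (t ^ α * (1 - t) ^ β) := by
      have h1 : ∀ᵐ t ∂(MeasureTheory.volume : MeasureTheory.Measure ℝ), t ≠ 1 := by
        simp [MeasureTheory.ae_iff]
      rw [MeasureTheory.ae_restrict_iff' measurableSet_uIoc]
      filter_upwards [h1] with t ht1 ht
      rw [Set.uIoc_of_le zero_le_one] at ht
      have : t < 1 := lt_of_le_of_ne ht.2 ht1
      exact mul_nonneg (hp t ht.1 this) (mul_nonneg (Real.rpow_nonneg ht.1.le _)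
        (Real.rpow_nonneg (by linarith) _))
    rw [intervalIntegral.integral_pos_iff_support_of_nonneg_ae' h0 (wtp_int hα hβ p)]
    refine ⟨zero_lt_one, ?_⟩
    have hsub : Set.Ioo (0:ℝ) 1 \ (p.roots.toFinset : Set ℝ) ⊆
        Function.support (fun t : ℝ => p.eval t * (t ^ α * (1 - t) ^ β)) ∩ Set.Ioc 0 1 := by
      rintro t ⟨⟨h0t, ht1⟩, ht⟩
      refine ⟨?_, h0t, ht1.le⟩
      simp only [Finset.mem_coe, Multiset.mem_toFinset, mem_roots hp0, IsRoot.def] at ht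
      exact mul_ne_zero ht (mul_ne_zero (Real.rpow_pos_of_pos h0t _).ne'
        (Real.rpow_pos_of_pos (by linarith) _).ne')
    refine lt_of_lt_of_le ?_ (MeasureTheory.measure_mono hsub)
    rw [MeasureTheory.measure_sdiff_null (Finset.measure_zero _ _)]
    simp
  · intro p
    simp only [LinearMap.coe_mk, AddHom.coe_mk]
    rw [← intervalIntegral.integral_add (wtp_int hα hβ _) (wtp_int hα hβ _)]
    have hc : ContinuousOn (fun t : ℝ => p.eval t * (t ^ (α + 1) * (1 - t) ^ (β + 1)))
        (Set.Icc 0 1) := by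
      apply Continuous.continuousOn
      refine p.continuous.mul (Continuous.mul ?_ ?_)
      · exact Real.continuous_rpow_const (by linarith)
      · exact (Real.continuous_rpow_const (by linarith)).comp (by fun_prop : Continuous fun t : ℝ => 1 - t)
    have key := intervalIntegral.integral_eq_sub_of_hasDerivAt_of_le (zero_le_one)
      (f := fun t : ℝ => p.eval t * (t ^ (α + 1) * (1 - t) ^ (β + 1)))
      (f' := fun t : ℝ => (X * (1 - X) * derivative p).eval t * (t ^ α * (1 - t) ^ β) +
        ((C (α + 1) - C (α + β + 2) * X) * p).eval t * (t ^ α * (1 - t) ^ β)) hc ?_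
        ((wtp_int hα hβ _).add (wtp_int hα hβ _))
    · rw [key]
      have h1 : α + 1 ≠ 0 := by linarith
      have h2 : β + 1 ≠ 0 := by linarith
      simp [Real.zero_rpow h1, Real.zero_rpow h2]
    · intro t ht
      have ht0 := ht.1
      have ht1 : 0 < 1 - t := by linarith [ht.2]
      have d1 := p.hasDerivAt t
      have d2 : HasDerivAt (fun t : ℝ => t ^ (α + 1)) ((α + 1) * t ^ α) t := by
        have := Real.hasDerivAt_rpow_const (x := t) (p := α + 1) (Or.inl ht0.ne')
        simpa using this
      have d3 : HasDerivAt (fun t : ℝ => (1 - t) ^ (β + 1)) (-((β + 1) * (1 - t) ^ β)) t := by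
        have h := Real.hasDerivAt_rpow_const (x := 1 - t) (p := β + 1) (Or.inl ht1.ne')
        have h2 : HasDerivAt (fun t : ℝ => 1 - t) (-1) t := by
          simpa using (hasDerivAt_id t).const_sub 1
        have := h.comp t h2
        simpa [Function.comp_def] using this
      convert! d1.mul (d2.mul d3) using 1
      simp only [eval_mul, eval_add, eval_sub, eval_X, eval_one, eval_C, Pi.mul_apply]
      rw [Real.rpow_add_one ht0.ne', Real.rpow_add_one ht1.ne']
      ring


lemma L_C_mul (L : ℝ[X] →ₗ[ℝ] ℝ) (a : ℝ) (p : ℝ[X]) : L (C a * p) = a * L p := by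
  rw [← smul_eq_C_mul, map_smul, smul_eq_mul]

lemma ode_of_rec {α γ : ℝ} {n : ℕ} (Q : ℝ[X])
    (hrec : ∀ j : ℕ, ((j:ℝ) + 1) * (j + 1 + α) * Q.coeff (j + 1) =
      ((j:ℝ) - n) * (j + n + γ) * Q.coeff j) :
    X * (1 - X) * derivative (derivative Q) + (C (α + 1) - C (γ + 1) * X) * derivative Q
      = C (-((n:ℝ) * (n + γ))) * Q := by
  have e : X * (1 - X) * derivative (derivative Q) + (C (α + 1) - C (γ + 1) * X) * derivative Q
    = X * derivative (derivative Q) - X * (X * derivative (derivative Q))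
      + C (α + 1) * derivative Q - C (γ + 1) * (X * derivative Q) := by ring
  rw [e]
  ext j
  have h := hrec j
  rcases j with _ | _ | j
  · simp [coeff_derivative] at h ⊢
    linarith
  · simp only [coeff_add, coeff_sub, coeff_C_mul, coeff_X_mul, coeff_derivative, coeff_X_mul_zero]
    push_cast at h ⊢
    norm_num at h ⊢
    linarith
  · simp only [coeff_add, coeff_sub, coeff_C_mul, coeff_X_mul, coeff_derivative]
    push_cast at h ⊢
    linarith

lemma orth_of_rec {α γ : ℝ} {n : ℕ} (hγ : -1 < γ) (L : ℝ[X] →ₗ[ℝ] ℝ)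
    (ibp : ∀ p : ℝ[X], L (X * (1 - X) * derivative p) +
        L ((C (α + 1) - C (γ + 1) * X) * p) = 0) (Q : ℝ[X])
    (hrec : ∀ j : ℕ, ((j:ℝ) + 1) * (j + 1 + α) * Q.coeff (j + 1) =
      ((j:ℝ) - n) * (j + n + γ) * Q.coeff j) :
    ∀ q : ℝ[X], q.degree < n → L (Q * q) = 0 := by
  have hode := ode_of_rec Q hrec
  have self : ∀ q : ℝ[X], -((n:ℝ) * (n + γ)) * L (Q * q) =
      L (Q * (X * (1 - X) * derivative (derivative q) +
        (C (α + 1) - C (γ + 1) * X) * derivative q)) := by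
    intro q
    have h := ibp (derivative Q * q - Q * derivative q)
    rw [← map_add] at h
    rw [← L_C_mul, ← sub_eq_zero, ← map_sub, ← h, ← mul_assoc, ← hode]
    congr 1
    simp only [derivative_sub, derivative_mul]
    ring
  have mono : ∀ k : ℕ, k < n → L (Q * X ^ k) = 0 := by
    intro k
    induction k with
    | zero =>
      intro hk
      have h := self 1
      simp at h
      have hn : (1:ℝ) ≤ n := by exact_mod_cast hk
      rcases h with (h | h) | h
      · exact absurd h (by omega)
      · linarith
      · simpa using h
    | succ k ih =>
      intro hk
      have h := self (X ^ (k + 1))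
      have e : Q * (X * (1 - X) * derivative (derivative (X ^ (k + 1))) +
          (C (α + 1) - C (γ + 1) * X) * derivative (X ^ (k + 1)))
          = C (((k:ℝ) + 1) * (k + 1 + α)) * (Q * X ^ k)
            - C (((k:ℝ) + 1) * (k + 1 + γ)) * (Q * X ^ (k + 1)) := by
        rcases k with _ | k
        · simp; ring
        · simp; ring
      rw [e, map_sub, L_C_mul, L_C_mul, ih (by omega)] at h
      have h2 : ((n:ℝ) - (k + 1)) * (n + k + 1 + γ) * L (Q * X ^ (k + 1)) = 0 := by
        linear_combination -h
      have hn : (k:ℝ) + 1 < n := by exact_mod_cast hk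
      have hk0 : (0:ℝ) ≤ k := by positivity
      rcases mul_eq_zero.1 h2 with h3 | h3
      · rcases mul_eq_zero.1 h3 with h4 | h4 <;> linarith
      · exact h3
  intro q hq
  by_cases hq0 : q = 0
  · simp [hq0]
  rw [q.as_sum_range_C_mul_X_pow, Finset.mul_sum, map_sum]
  apply Finset.sum_eq_zero
  intro k hk
  rw [mul_left_comm, L_C_mul, mono k, mul_zero]
  have := (natDegree_lt_iff_degree_lt hq0).2 hq
  rw [Finset.mem_range] at hk
  omega

set_option maxHeartbeats 1000000 in
lemma stable_core {α β : ℝ} {n : ℕ} (hα1 : -1 < α) (hα2 : α < 1) (hβ : -1 < β)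
    (L : ℝ[X] →ₗ[ℝ] ℝ)
    (pos : ∀ p : ℝ[X], p ≠ 0 → (∀ t : ℝ, 0 < t → t < 1 → 0 ≤ p.eval t) → 0 < L p)
    (ibp : ∀ p : ℝ[X], L (X * (1 - X) * derivative p) +
        L ((C (α + 1) - C (α + β + 2) * X) * p) = 0)
    (Q F1 F2 : ℝ[X]) (hQ : Q ≠ 0)
    (orth : ∀ q : ℝ[X], q.degree < n → L (Q * q) = 0)
    (hd1 : ∀ m, n < m → F1.coeff m = 0) (hd2 : ∀ m, n < m → F2.coeff m = 0)
    (a b : ℝ) (e1 : F1 + C a * derivative F1 - C b * derivative F2 = Q)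
    (e2 : F2 + C a * derivative F2 + C b * derivative F1 = 0)
    (h01 : F1.coeff 0 = 0) (h02 : F2.coeff 0 = 0) : a < 0 := by
  have hF' : ∀ F : ℝ[X], (∀ m, n < m → F.coeff m = 0) → L (Q * derivative F) = 0 := by
    intro F hF
    apply orth
    rw [degree_lt_iff_coeff_zero]
    intro m hm
    rw [coeff_derivative, hF (m + 1) (by omega), zero_mul]
  have hG : ∀ G : ℝ[X], (∀ m, n < m → (X * G).coeff m = 0) → L (Q * G) = 0 := by
    intro F hF
    apply orth
    rw [degree_lt_iff_coeff_zero]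
    intro m hm
    rw [← coeff_X_mul, hF (m + 1) (by omega)]
  obtain ⟨G1, rfl⟩ := X_dvd_iff.2 h01
  obtain ⟨G2, rfl⟩ := X_dvd_iff.2 h02
  have f1 := hF' _ hd1
  have f2 := hF' _ hd2
  have g1 := hG _ hd1
  have g2 := hG _ hd2
  set D1 := derivative (X * G1) with hD1
  set D2 := derivative (X * G2) with hD2
  have hh : 0 < L (Q * Q) := by
    apply pos _ (mul_ne_zero hQ hQ)
    intro t _ _
    rw [eval_mul]; exact mul_self_nonneg _
  set N := G1 ^ 2 + G2 ^ 2 with hN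
  have hN0 : N ≠ 0 := by
    intro h
    have hz : ∀ t : ℝ, G1.eval t = 0 ∧ G2.eval t = 0 := by
      intro t
      have h1 : N.eval t = 0 := by rw [h]; simp
      rw [hN] at h1
      simp only [eval_add, eval_pow] at h1
      constructor <;> nlinarith [sq_nonneg (G1.eval t), sq_nonneg (G2.eval t)]
    have z1 : G1 = 0 := Polynomial.funext (fun t => by simpa using (hz t).1)
    have z2 : G2 = 0 := Polynomial.funext (fun t => by simpa using (hz t).2)
    apply hQ
    rw [← e1, hD1, hD2, z1, z2]; simp
  have hNe : ∀ t : ℝ, 0 ≤ N.eval t := by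
    intro t; rw [hN]; simp only [eval_add, eval_pow]; positivity
  have hA : 0 ≤ L (X * (1 - X) * N) := by
    refine (pos _ (mul_ne_zero (mul_ne_zero X_ne_zero ?_) hN0) ?_).le
    · intro h
      have := congrArg (fun p => p.eval (0:ℝ)) h
      simp at this
    · intro t h0 h1
      simp only [eval_mul, eval_X, eval_sub, eval_one]
      exact mul_nonneg (mul_nonneg h0.le (by linarith)) (hNe t)
  -- the real part of the pairing
  set B1 := L ((1 - X) * (D1 * G1 + D2 * G2)) with hB1
  set B2 := L ((1 - X) * (D2 * G1 - D1 * G2)) with hB2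
  have hB : 0 < B1 := by
    have hp : 0 < L ((C (1 - α) * (1 - X) + C (β + 1) * X) * N) := by
      refine pos _ (mul_ne_zero ?_ hN0) ?_
      · intro h
        have := congrArg (fun p => p.eval (1:ℝ)) h
        simp at this
        linarith
      · intro t h0 h1
        simp only [eval_mul, eval_X, eval_sub, eval_one, eval_add, eval_C]
        refine mul_nonneg (add_nonneg ?_ ?_) (hNe t)
        · exact mul_nonneg (by linarith) (by linarith)
        · exact mul_nonneg (by linarith) h0.le
    have h := ibp N
    have h2 : 2 * B1 = L ((C (1 - α) * (1 - X) + C (β + 1) * X) * N) := by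
      rw [hB1, ← L_C_mul, ← sub_eq_zero, ← map_sub, ← h, ← map_add]
      congr 1
      rw [hD1, hD2, hN]
      simp only [derivative_mul, derivative_X, derivative_add, derivative_pow, C_add, C_sub, C_1]
      have : (C 2 : ℝ[X]) = 2 := rfl
      simp only [this]
      simp only [Nat.cast_ofNat, Nat.add_one_sub_one, pow_one, this]
      ring
    linarith
  have t1 : L (X * (1 - X) * N) + a * B1 - b * B2 = - L (Q * Q) := by
    have hQF : L (Q * (X * G1)) = L (Q * Q) := by
      have : Q * (X * G1) = Q * Q - C a * (Q * D1) + C b * (Q * D2) := by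
        linear_combination Q * e1
      rw [this, map_add, map_sub, L_C_mul, L_C_mul, f1, f2]; ring
    have : X * (1 - X) * N + C a * ((1 - X) * (D1 * G1 + D2 * G2))
        - C b * ((1 - X) * (D2 * G1 - D1 * G2)) = Q * G1 - Q * (X * G1) := by
      rw [hN]
      linear_combination ((1 - X) * G1) * e1 + ((1 - X) * G2) * e2
    have := congrArg L this
    rw [map_sub, map_add, map_sub, L_C_mul, L_C_mul, g1, hQF] at this
    linarith
  have t2 : a * B2 + b * B1 = 0 := by
    have hQF : L (Q * (X * G2)) = 0 := by
      have : Q * (X * G2) = - (C a * (Q * D2)) - C b * (Q * D1) := by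
        linear_combination Q * e2
      rw [this, map_sub, map_neg, L_C_mul, L_C_mul, f1, f2]; ring
    have : C a * ((1 - X) * (D2 * G1 - D1 * G2)) + C b * ((1 - X) * (D1 * G1 + D2 * G2))
         = -(Q * G2) + Q * (X * G2) := by
      linear_combination ((1 - X) * G1) * e2 - ((1 - X) * G2) * e1
    have := congrArg L this
    rw [map_add, map_add, L_C_mul, L_C_mul, map_neg, g2, hQF] at this
    linarith
  clear_value B1 B2
  by_contra hna
  push Not at hna
  have : (L (X * (1 - X) * N) + L (Q * Q)) * B1 = -a * (B1 ^ 2 + B2 ^ 2) := by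
    linear_combination B1 * t1 + B2 * t2
  have h1 : 0 < (L (X * (1 - X) * N) + L (Q * Q)) * B1 := mul_pos (by linarith) hB
  have h2 : 0 ≤ a * (B1 ^ 2 + B2 ^ 2) :=
    mul_nonneg hna (add_nonneg (sq_nonneg _) (sq_nonneg _))
  linarith

lemma splits_of_real {E : ℝ[X]} (hE : E ≠ 0) (h : ∀ w : ℂ, aeval w E = 0 → w.im = 0) :
    E.Splits := by
  apply Splits.of_splits_map_of_injective (i := algebraMap ℝ ℂ) (algebraMap ℝ ℂ).injective
    (IsAlgClosed.splits _)
  intro w hw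
  have hw' : aeval w E = 0 := by
    rw [mem_roots (by simpa [Polynomial.map_eq_zero] using hE)] at hw
    simpa [IsRoot.def, eval_map_algebraMap] using hw
  exact ⟨w.re, Complex.ext (by simp) (by simp [h w hw'])⟩

lemma aeval_conj' (f : ℝ[X]) (z : ℂ) :
    aeval ((starRingEnd ℂ) z) f = (starRingEnd ℂ) (aeval z f) := by
  exact Polynomial.aeval_conj f z

lemma hb {f E : ℝ[X]} (hfE : f + f.comp (-X) = 2 * E.comp (X ^ 2))
    (hst : ∀ z : ℂ, aeval z f = 0 → z.re < 0) (hdeg : 1 ≤ f.natDegree) :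
    E.Splits ∧ E.roots.Nodup ∧ (∀ x ∈ E.roots, x < 0) := by
  have hf0 : f ≠ 0 := by rintro rfl; simp at hdeg
  have hfe : ∀ z : ℂ, aeval z f + aeval (-z) f = 2 * aeval (z ^ 2) E := by
    intro z
    have := congrArg (aeval z) hfE
    have h2 : aeval z (2 : ℝ[X]) = 2 := map_ofNat _ 2
    simpa [aeval_comp, h2] using this
  have hfd : ∀ z : ℂ, aeval z (derivative f) - aeval (-z) (derivative f)
      = 4 * z * aeval (z ^ 2) (derivative E) := by
    intro z
    have := congrArg (fun p => aeval z (derivative p)) hfE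
    simp [derivative_comp, aeval_comp] at this
    have h2 : aeval z (2 : ℝ[X]) = 2 := map_ofNat _ 2
    rw [h2] at this
    linear_combination this
  set g : ℂ[X] := f.map (algebraMap ℝ ℂ) with hg
  have hg0 : g ≠ 0 := by rw [hg]; simpa [Polynomial.map_eq_zero] using hf0
  have hgs : g.Splits := IsAlgClosed.splits g
  have hge : ∀ z : ℂ, g.eval z = aeval z f := fun z => by rw [hg, eval_map_algebraMap]
  have hroots : ∀ r ∈ g.roots, r.re < 0 := by
    intro r hr
    rw [mem_roots hg0, IsRoot.def, hge] at hr
    exact hst r hr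
  have hcard : g.roots ≠ 0 := by
    apply hgs.roots_ne_zero
    rw [hg, natDegree_map]; omega
  have hE0 : aeval (0:ℂ) E ≠ 0 := by
    intro h
    have := hfe 0
    simp [h] at this
    have h2 := hst 0 this
    simp at h2
  have hEne : E ≠ 0 := by rintro rfl; simp at hE0
  -- strict inequality
  have hlt : ∀ z : ℂ, 0 < z.re → ‖aeval (-z) f‖ < ‖aeval z f‖ := by
    intro z hz
    have e1 : ‖aeval (-z) f‖ = ‖g.eval (-(starRingEnd ℂ) z)‖ := by
      rw [hge, ← map_neg, aeval_conj', Complex.norm_conj]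
    rw [e1, ← hge, hgs.eval_eq_prod_roots, hgs.eval_eq_prod_roots, norm_mul, norm_mul]
    apply mul_lt_mul_of_pos_left _ (by simpa using hg0)
    have nm : ∀ (s : Multiset ℂ) (w : ℂ), ‖(s.map (fun r => w - r)).prod‖ =
        (s.map (fun r => ‖w - r‖)).prod := by
      intro s w
      induction s using Multiset.induction_on with
      | empty => simp
      | cons a s ih => simp [ih]
    rw [nm, nm]
    have hpt : ∀ r ∈ g.roots, ‖-(starRingEnd ℂ) z - r‖ < ‖z - r‖ := by
      intro r hr
      have hr' := hroots r hr
      rw [Complex.norm_def, Complex.norm_def]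
      apply Real.sqrt_lt_sqrt (Complex.normSq_nonneg _)
      simp only [Complex.normSq_apply, Complex.sub_re, Complex.neg_re, Complex.conj_re,
        Complex.sub_im, Complex.neg_im, Complex.conj_im]
      nlinarith [mul_pos hz (neg_pos.2 hr')]
    have gen : ∀ s : Multiset ℂ, (∀ r ∈ s, ‖-(starRingEnd ℂ) z - r‖ < ‖z - r‖) →
        (s.map (fun r => ‖-(starRingEnd ℂ) z - r‖)).prod ≤ (s.map (fun r => ‖z - r‖)).prod ∧
        (s ≠ 0 → (s.map (fun r => ‖-(starRingEnd ℂ) z - r‖)).prod <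
          (s.map (fun r => ‖z - r‖)).prod) ∧ 0 < (s.map (fun r => ‖z - r‖)).prod ∧
          0 ≤ (s.map (fun r => ‖-(starRingEnd ℂ) z - r‖)).prod := by
      intro s
      induction s using Multiset.induction_on with
      | empty => intro _; simp
      | cons a s ih =>
        intro hs
        obtain ⟨i1, -, i3, i4⟩ := ih (fun r hr => hs r (Multiset.mem_cons_of_mem hr))
        have ha := hs a (Multiset.mem_cons_self a s)
        have ha0 := norm_nonneg (-(starRingEnd ℂ) z - a)
        simp only [Multiset.map_cons, Multiset.prod_cons]
        have hlt : ‖-(starRingEnd ℂ) z - a‖ * (s.map (fun r => ‖-(starRingEnd ℂ) z - r‖)).prod <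
          ‖z - a‖ * (s.map (fun r => ‖z - r‖)).prod :=
          (mul_le_mul_of_nonneg_left i1 ha0).trans_lt (mul_lt_mul_of_pos_right ha i3)
        exact ⟨hlt.le, fun _ => hlt, mul_pos (ha0.trans_lt ha) i3, mul_nonneg ha0 i4⟩
    exact (gen _ hpt).2.1 hcard
  have hreal : ∀ w : ℂ, aeval w E = 0 → ∃ z : ℂ, z ^ 2 = w ∧ z.re = 0 := by
    intro w hw
    obtain ⟨z, hz⟩ := IsAlgClosed.exists_pow_nat_eq w (n := 2) (by norm_num)
    have key : ∀ z : ℂ, z ^ 2 = w → ¬ 0 < z.re := by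
      intro z hz hp
      have h := hfe z
      rw [hz, hw, mul_zero] at h
      have h2 := hlt z hp
      rw [eq_neg_of_add_eq_zero_left h, norm_neg] at h2
      exact lt_irrefl _ h2
    refine ⟨z, hz, ?_⟩
    have h1 := key z hz
    have h2 := key (-z) (by rw [neg_sq, hz])
    simp at h1 h2
    linarith
  have hroot : ∀ x : ℝ, E.IsRoot x → ∃ y : ℝ, y ≠ 0 ∧ x = - y ^ 2 := by
    intro x hx
    have hx' : aeval (x:ℂ) E = 0 := by
      have := Polynomial.aeval_algebraMap_apply ℂ x E
      simp [IsRoot.def] at hx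
      simpa [hx] using this
    obtain ⟨z, hz, hz0⟩ := hreal _ hx'
    have hzz : z = z.im * Complex.I := Complex.ext (by simp [hz0]) (by simp)
    refine ⟨z.im, ?_, ?_⟩
    · intro h
      rw [h] at hzz
      simp at hzz
      rw [hzz] at hz
      apply hE0
      rw [← hz] at hx'
      simpa using hx'
    · have := congrArg Complex.re hz
      simp [pow_two, hz0] at this
      rw [← this]; ring
  refine ⟨splits_of_real hEne ?_, ?_, ?_⟩
  · intro w hw
    obtain ⟨z, hz, hz0⟩ := hreal w hw
    rw [← hz, pow_two]; simp [hz0]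
  · rw [Multiset.nodup_iff_count_le_one]
    intro x
    rw [count_roots]
    by_contra hc
    push Not at hc
    rw [one_lt_rootMultiplicity_iff_isRoot hEne] at hc
    obtain ⟨hr, hd⟩ := hc
    obtain ⟨y, hy0, rfl⟩ := hroot x hr
    set z : ℂ := y * Complex.I with hz
    have hz2 : z ^ 2 = ((-y ^ 2 : ℝ) : ℂ) := by
      rw [hz, mul_pow, Complex.I_sq]; push_cast; ring
    have hzc : -z = (starRingEnd ℂ) z := by simp [hz]
    have v0 : aeval (z ^ 2) E = 0 := by
      rw [hz2]
      have := Polynomial.aeval_algebraMap_apply ℂ (-y ^ 2) E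
      rw [IsRoot.def] at hr
      rw [coe_aeval_eq_eval, hr] at this
      simpa using this
    have v1 : aeval (z ^ 2) (derivative E) = 0 := by
      rw [hz2]
      have := Polynomial.aeval_algebraMap_apply ℂ (-y ^ 2) (derivative E)
      rw [IsRoot.def] at hd
      rw [coe_aeval_eq_eval, hd] at this
      simpa using this
    have h1 := hfe z
    have h2 := hfd z
    rw [v0, hzc, aeval_conj'] at h1
    rw [v1, hzc, aeval_conj'] at h2
    have h1' := congrArg Complex.re h1
    have h2' := congrArg Complex.im h2
    simp at h1' h2'
    have hzf : g.eval z ≠ 0 := by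
      rw [hge]
      intro h
      have := hst z h
      simp [hz] at this
    have hL := hgs.eval_derivative_div_eval_of_ne_zero hzf
    have hg' : (derivative g).eval z = aeval z (derivative f) := by
      rw [hg, derivative_map, eval_map_algebraMap]
    rw [hg', hge] at hL
    have hre : (aeval z (derivative f) / aeval z f).re = 0 := by
      rw [Complex.div_re]
      have : (aeval z f).re = 0 := by linarith
      have h3 : (aeval z (derivative f)).im = 0 := by linarith
      rw [this, h3]; simp
    rw [hL] at hre
    have gen : ∀ s : Multiset ℂ, (∀ r ∈ s, r.re < 0) →
        0 ≤ ((s.map (fun r => 1 / (z - r))).sum).re ∧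
        (s ≠ 0 → 0 < ((s.map (fun r => 1 / (z - r))).sum).re) := by
      intro s
      induction s using Multiset.induction_on with
      | empty => intro _; simp
      | cons a s ih =>
        intro hs
        obtain ⟨i1, -⟩ := ih (fun r hr => hs r (Multiset.mem_cons_of_mem hr))
        have ha := hs a (Multiset.mem_cons_self a s)
        have hp : 0 < (1 / (z - a)).re := by
          rw [one_div, Complex.inv_re]
          have hzr : z.re = 0 := by simp [hz]
          have hza : 0 < (z - a).re := by rw [Complex.sub_re, hzr]; linarith
          apply div_pos hza
          rw [Complex.normSq_pos]
          intro h; rw [h] at hza; simp at hza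
        simp only [Multiset.map_cons, Multiset.sum_cons, Complex.add_re]
        exact ⟨by linarith, fun _ => by linarith⟩
    have := (gen _ hroots).2 hcard
    linarith
  · intro x hx
    obtain ⟨y, hy, rfl⟩ := hroot x ((mem_roots hEne).1 hx)
    have := sq_pos_of_ne_zero hy
    linarith


lemma V_pos (s : Multiset ℝ) (hs : s.Nodup) (hneg : ∀ r ∈ s, r < 0) (g : ℝ[X])
    (hg : g = (s.map (fun r => X - C r)).prod) (x : ℝ) :
    0 ≤ (g * derivative (X * derivative g) - derivative g * (X * derivative g)).eval x ∧
    (s ≠ 0 → 0 < (g * derivative (X * derivative g) - derivative g * (X * derivative g)).eval x) := by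
  induction s using Multiset.induction_on generalizing g with
  | empty => simp at hg; simp [hg]
  | cons r s ih =>
    set h := (s.map (fun r => X - C r)).prod with hh
    rw [Multiset.nodup_cons] at hs
    obtain ⟨i1, i2⟩ := ih hs.2 (fun r hr => hneg r (Multiset.mem_cons_of_mem hr)) h rfl
    have hr := hneg r (Multiset.mem_cons_self r s)
    have e : g * derivative (X * derivative g) - derivative g * (X * derivative g)
      = (X - C r) ^ 2 * (h * derivative (X * derivative h) - derivative h * (X * derivative h))
        - C r * h ^ 2 := by
      rw [hg, Multiset.map_cons, Multiset.prod_cons, ← hh]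
      simp only [derivative_mul, derivative_sub, derivative_X, derivative_C, derivative_add,
        derivative_one, derivative_zero]
      ring
    have main : 0 < (g * derivative (X * derivative g) -
        derivative g * (X * derivative g)).eval x := by
      rw [e]
      generalize h * derivative (X * derivative h) - derivative h * (X * derivative h) = V at *
      simp only [eval_sub, eval_mul, eval_pow, eval_X, eval_C]
      have p1 : 0 ≤ (x - r) ^ 2 * V.eval x := mul_nonneg (sq_nonneg _) i1
      have p2 : 0 ≤ (-r) * (h.eval x) ^ 2 := mul_nonneg (by linarith) (sq_nonneg _)
      by_cases hx : h.eval x = 0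
      · have hs0 : s ≠ 0 := by
          rintro rfl
          simp [hh] at hx
        have hxr : x ≠ r := by
          rintro rfl
          rw [hh, eval_multiset_prod, Multiset.prod_eq_zero_iff] at hx
          simp at hx
          obtain ⟨a, ha, ha2⟩ := hx
          have : x = a := by linarith
          exact hs.1 (this ▸ ha)
        have p3 : 0 < (x - r) ^ 2 * V.eval x :=
          mul_pos (sq_pos_of_ne_zero (sub_ne_zero.2 hxr)) (i2 hs0)
        linarith
      · have p3 : 0 < (-r) * (h.eval x) ^ 2 := mul_pos (by linarith) (sq_pos_of_ne_zero hx)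
        linarith
    exact ⟨main.le, fun _ => main⟩

lemma rolle_root {A B : ℝ[X]}
    (hW : ∀ x : ℝ, (derivative A).eval x * B.eval x - A.eval x * (derivative B).eval x ≠ 0)
    {x y : ℝ} (hx : A.IsRoot x) (hy : A.IsRoot y) (hxy : x < y) :
    ∃ z, B.IsRoot z ∧ x < z ∧ z < y := by
  by_contra hcon
  push Not at hcon
  rw [IsRoot.def] at hx hy
  have hB : ∀ t ∈ Set.Icc x y, B.eval t ≠ 0 := by
    intro t ht h
    rcases eq_or_lt_of_le ht.1 with h1 | h1
    · apply hW t; rw [h, ← h1, hx]; ring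
    rcases eq_or_lt_of_le ht.2 with h2 | h2
    · apply hW t; rw [h, h2, hy]; ring
    exact absurd h2 (not_lt.2 (hcon t h h1))
  obtain ⟨c, hc, hc0⟩ := exists_hasDerivAt_eq_zero (f := fun t => A.eval t / B.eval t)
    (f' := fun t => ((derivative A).eval t * B.eval t - A.eval t * (derivative B).eval t) /
      (B.eval t) ^ 2) hxy
    (A.continuous.continuousOn.div B.continuous.continuousOn hB) (by simp [hx, hy])
    (fun t ht => (A.hasDerivAt t).fun_div (B.hasDerivAt t) (hB t ⟨ht.1.le, ht.2.le⟩))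
  rcases div_eq_zero_iff.1 hc0 with h | h
  · exact hW c h
  · exact hB c ⟨hc.1.le, hc.2.le⟩ (by simpa using h)

lemma half_interlace {A B : ℝ[X]}
    (hW : ∀ x : ℝ, (derivative A).eval x * B.eval x - A.eval x * (derivative B).eval x ≠ 0) :
    ∀ x y : ℝ, A.IsRoot x → A.IsRoot y → x < y →
      (∀ t : ℝ, A.IsRoot t → ¬(x < t ∧ t < y)) →
      ∃! z : ℝ, B.IsRoot z ∧ x < z ∧ z < y := by
  intro x y hx hy hxy hcons
  obtain ⟨z, hz, hz1, hz2⟩ := rolle_root hW hx hy hxy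
  have hW' : ∀ x : ℝ, (derivative B).eval x * A.eval x - B.eval x * (derivative A).eval x ≠ 0 := by
    intro x h
    apply hW x
    linear_combination -h
  refine ⟨z, ⟨hz, hz1, hz2⟩, ?_⟩
  rintro w ⟨hw, hw1, hw2⟩
  by_contra hne
  rcases lt_or_gt_of_ne hne with h | h
  · obtain ⟨t, ht, h1, h2⟩ := rolle_root hW' hw hz h
    exact hcons t ht ⟨by linarith, by linarith⟩
  · obtain ⟨t, ht, h1, h2⟩ := rolle_root hW' hz hw h
    exact hcons t ht ⟨by linarith, by linarith⟩

lemma wronskian_ne {g A B : ℝ[X]} {a b s n : ℝ} (hsp : g.Splits) (hnd : g.roots.Nodup)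
    (hneg : ∀ r ∈ g.roots, r < 0) (hdeg : 1 ≤ g.natDegree) (ha : a ≠ 0) (hb : b ≠ 0)
    (hsn : s + n ≠ 0) (hA : A = C a * (C s * g + C 2 * (X * derivative g)))
    (hB : B = C b * (C n * g - C 2 * (X * derivative g))) (x : ℝ) :
    (derivative A).eval x * B.eval x - A.eval x * (derivative B).eval x ≠ 0 := by
  have hg0 : g ≠ 0 := by rintro rfl; simp at hdeg
  set h := (g.roots.map (fun r => X - C r)).prod with hh
  have hgh : g = C g.leadingCoeff * h := hsp.eq_prod_roots
  have hV := (V_pos g.roots hnd hneg h hh x).2 (hsp.roots_ne_zero (by omega))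
  set l := g.leadingCoeff with hl
  have hl0 : l ≠ 0 := leadingCoeff_ne_zero.2 hg0
  clear_value l h
  have : (derivative A).eval x * B.eval x - A.eval x * (derivative B).eval x
     = 2 * a * b * (s + n) * l ^ 2 *
      (h * derivative (X * derivative h) - derivative h * (X * derivative h)).eval x := by
    rw [hA, hB, hgh]
    simp only [derivative_mul, derivative_sub, derivative_X, derivative_C, derivative_add,
        eval_mul, eval_add, eval_sub, eval_X, eval_C, zero_mul, zero_add, one_mul]
    ring
  rw [this]
  exact mul_ne_zero (mul_ne_zero (mul_ne_zero (mul_ne_zero (mul_ne_zero two_ne_zero ha) hb) hsn)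
    (pow_ne_zero 2 hl0)) (ne_of_gt hV)

/-- The hypergeometric coefficient `(-n)_j (s)_j / (α+1)_j`. -/
noncomputable def dco (α s : ℝ) (n j : ℕ) : ℝ :=
  (ascPochhammer ℝ j).eval (-(n:ℝ)) * (ascPochhammer ℝ j).eval s /
    (ascPochhammer ℝ j).eval (α + 1)

lemma dco_succ {α s : ℝ} (hα : -1 < α) (n j : ℕ) :
    ((j:ℝ) + 1 + α) * dco α s n (j + 1) = ((j:ℝ) - n) * (j + s) * dco α s n j := by
  unfold dco
  rw [ascPochhammer_succ_eval, ascPochhammer_succ_eval, ascPochhammer_succ_eval]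
  have h1 := (ascPochhammer_pos j (α + 1) (by linarith)).ne'
  have h2 : α + 1 + (j:ℝ) ≠ 0 := by
    have : (0:ℝ) ≤ j := by positivity
    linarith
  field_simp
  ring

lemma dco_zero_of_lt {α s : ℝ} {n j : ℕ} (h : n < j) : dco α s n j = 0 := by
  unfold dco
  rw [ascPochhammer_eval_neg_coe_nat_of_lt h]; simp

lemma dco_ne {α s : ℝ} {n j : ℕ} (hα : -1 < α) (hs : 0 < s) (h : j ≤ n) : dco α s n j ≠ 0 := by
  unfold dco
  refine div_ne_zero (mul_ne_zero ?_ (ascPochhammer_pos j s hs).ne')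
    (ascPochhammer_pos j (α + 1) (by linarith)).ne'
  intro h0
  rw [ascPochhammer_eval_eq_zero_iff] at h0
  obtain ⟨k, hk, hk2⟩ := h0
  simp at hk2
  have : k = n := by exact_mod_cast hk2
  omega

lemma poch_shift (s : ℝ) (k : ℕ) : (s + k) * (ascPochhammer ℝ k).eval s =
    s * (ascPochhammer ℝ k).eval (s + 1) := by
  induction k with
  | zero => simp
  | succ k ih =>
    rw [ascPochhammer_succ_eval, ascPochhammer_succ_eval]
    push_cast
    linear_combination (s + 1 + k) * ih

lemma dco_shift_s (α s : ℝ) (n j : ℕ) : (s + j) * dco α s n j = s * dco α (s + 1) n j := by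
  unfold dco
  linear_combination ((ascPochhammer ℝ j).eval (-(n:ℝ)) / (ascPochhammer ℝ j).eval (α + 1)) *
    poch_shift s j

lemma dco_shift_n (α s : ℝ) (n j : ℕ) :
    ((n:ℝ) + 1 - j) * dco α s (n + 1) j = (n + 1) * dco α s n j := by
  unfold dco
  have h := poch_shift (-((n + 1 : ℕ):ℝ)) j
  have e : -((n + 1 : ℕ):ℝ) + 1 = -(n:ℝ) := by push_cast; ring
  rw [e] at h
  push_cast at h ⊢
  linear_combination (-(ascPochhammer ℝ j).eval s / (ascPochhammer ℝ j).eval (α + 1)) * h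

lemma iter_eval (m j : ℕ) :
    (derivative^[m] ((C (1 / 2 : ℝ) * (1 - X)) ^ j)).eval 1 =
      if m = j then (m.factorial : ℝ) * (-1/2) ^ m else 0 := by
  have e : (C (1 / 2 : ℝ) * (1 - X)) ^ j = C ((-1/2 : ℝ) ^ j) * (X - C 1) ^ j := by
    rw [C_pow, ← mul_pow]
    congr 1
    have : (C (-1/2 : ℝ)) = - C (1/2 : ℝ) := by rw [← C_neg]; norm_num
    rw [this, C_1]; ring
  rw [e, iterate_derivative_C_mul, iterate_derivative_X_sub_pow]
  simp only [eval_mul, eval_C, eval_smul, eval_pow, eval_sub, eval_X, sub_self, nsmul_eq_mul,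
    eval_natCast]
  split_ifs with h
  · subst h; simp [Nat.descFactorial_self]; ring
  · rcases lt_or_gt_of_ne h with h | h
    · simp [zero_pow (by omega : j - m ≠ 0)]
    · simp [Nat.descFactorial_eq_zero_iff_lt.2 h]

lemma phi_eq (α β : ℝ) (n : ℕ) :
    phi α β n = C ((ascPochhammer ℝ n).eval (α + 1) / (n.factorial : ℝ)) *
      ∑ k ∈ Finset.range (n / 2 + 1),
        C ((-1/2 : ℝ) ^ (2 * k) * dco α (n + α + β + 1) n (2 * k)) * X ^ k := by
  unfold phi
  rw [Finset.mul_sum]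
  apply Finset.sum_congr rfl
  intro k hk
  rw [← mul_assoc, ← C_mul]
  congr 2
  unfold jacobiP
  rw [iterate_derivative_C_mul, iterate_derivative_sum]
  simp only [iterate_derivative_C_mul, eval_mul, eval_C, eval_finsetSum, iter_eval]
  congr 1
  rw [Finset.sum_eq_single (2 * k)]
  · rw [if_pos rfl]
    unfold dco
    have : ((2 * k).factorial : ℝ) ≠ 0 := by positivity
    rw [div_mul_eq_mul_div, mul_div_assoc', mul_comm ((2 * k).factorial : ℝ) (eval _ _)]
    by_cases h0 : (ascPochhammer ℝ (2 * k)).eval (α + 1) = 0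
    · simp [h0]
    · field_simp
  · intro b _ hb
    rw [if_neg (Ne.symm hb), mul_zero]
  · intro h
    exfalso; apply h
    rw [Finset.mem_range] at hk ⊢
    omega

lemma coeff_sum_dco (e : ℕ → ℝ) (N : ℕ) (he : ∀ j, N < j → e j = 0) (j : ℕ) :
    (∑ k ∈ Finset.range (N + 1), C (e k) * X ^ k).coeff j = e j := by
  simp only [finsetSum_coeff, coeff_C_mul_X_pow]
  rw [Finset.sum_ite_eq]
  split_ifs with h
  · rfl
  · rw [Finset.mem_range] at h
    exact (he j (by omega)).symm

/-- Hurwitz stability of the full polynomial. -/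
lemma f_stable {α β : ℝ} {n : ℕ} (hα1 : -1 < α) (hα2 : α < 1) (hβ : -1 < β) (hn : 1 ≤ n)
    (μ : ℂ) (h : aeval μ (∑ k ∈ Finset.range (n + 1),
      C ((-1/2 : ℝ) ^ k * dco α (n + α + β + 1) n k) * X ^ k) = 0) : μ.re < 0 := by
  obtain ⟨L, pos, ibp⟩ := exists_functional hα1 hβ
  have hn' : (1:ℝ) ≤ n := by exact_mod_cast hn
  set s : ℝ := n + α + β + 1 with hs
  set Q : ℝ[X] := ∑ k ∈ Finset.range (n + 1), C (dco α s n k / k.factorial) * X ^ k with hQ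
  have hQc : ∀ j, Q.coeff j = dco α s n j / j.factorial := by
    intro j
    rw [hQ]
    exact coeff_sum_dco (fun k => dco α s n k / k.factorial) n
      (fun j hj => by simp [dco_zero_of_lt hj]) j
  have hrec : ∀ j : ℕ, ((j:ℝ) + 1) * (j + 1 + α) * Q.coeff (j + 1) =
      ((j:ℝ) - n) * (j + n + (α + β + 1)) * Q.coeff j := by
    intro j
    rw [hQc, hQc, Nat.factorial_succ]
    have h := dco_succ (s := s) hα1 n j
    have : (j.factorial : ℝ) ≠ 0 := by positivity
    have : ((j:ℝ) + 1) ≠ 0 := by positivity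
    push_cast
    field_simp
    rw [h, hs]; ring
  have hQ0 : Q ≠ 0 := by
    intro h0
    have := hQc 0
    rw [h0] at this
    simp [dco] at this
  have orth := orth_of_rec (α := α) (γ := α + β + 1) (n := n) (by linarith) L (by
    intro p
    have := ibp p
    rwa [show α + β + 2 = α + β + 1 + 1 by ring] at this) Q hrec
  set z : ℂ := -(μ / 2) with hz
  have hd : ∀ c : ℕ → ℝ, ∀ m, n < m →
      (∑ k ∈ Finset.range (n + 1), C (c k) * derivative^[k] Q).coeff m = 0 := by
    intro c m hm
    rw [finsetSum_coeff]
    apply Finset.sum_eq_zero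
    intro k _
    rw [coeff_C_mul, coeff_iterate_derivative, hQc, dco_zero_of_lt (by omega)]
    simp
  have h0 : ∀ c : ℕ → ℝ,
      (∑ k ∈ Finset.range (n + 1), C (c k) * derivative^[k] Q).coeff 0 =
        ∑ k ∈ Finset.range (n + 1), c k * dco α s n k := by
    intro c
    rw [finsetSum_coeff]
    apply Finset.sum_congr rfl
    intro k _
    rw [coeff_C_mul, coeff_iterate_derivative, hQc]
    have : (k.factorial : ℝ) ≠ 0 := by positivity
    rw [zero_add, Nat.descFactorial_self, nsmul_eq_mul]
    field_simp
  have hDn : derivative^[n + 1] Q = 0 := by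
    ext m
    rw [coeff_iterate_derivative, hQc, dco_zero_of_lt (by omega)]
    simp
  have hsum : ∑ k ∈ Finset.range (n + 1), z ^ k * (dco α s n k : ℂ) = 0 := by
    rw [← h, map_sum]
    apply Finset.sum_congr rfl
    intro k _
    simp only [map_mul, aeval_C, map_pow, aeval_X, Complex.coe_algebraMap]
    rw [hz, show -(μ / 2) = (-1/2 : ℂ) * μ by ring, mul_pow]
    push_cast
    ring
  have der : ∀ c : ℕ → ℝ, derivative (∑ k ∈ Finset.range (n + 1), C (c k) * derivative^[k] Q)
      = ∑ k ∈ Finset.range (n + 1), C (c k) * derivative^[k + 1] Q := by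
    intro c
    rw [derivative_sum]
    apply Finset.sum_congr rfl
    intro k _
    rw [derivative_C_mul, Function.iterate_succ_apply']
  have tele : ∀ c : ℕ → ℝ, ∑ k ∈ Finset.range (n + 1),
      (C (c k) * derivative^[k] Q - C (c (k + 1)) * derivative^[k + 1] Q) = C (c 0) * Q := by
    intro c
    rw [Finset.sum_range_sub' (fun k => C (c k) * derivative^[k] Q), hDn]
    simp
  have key := stable_core hα1 hα2 hβ L pos ibp Q
    (∑ k ∈ Finset.range (n + 1), C ((z ^ k).re) * derivative^[k] Q)
    (∑ k ∈ Finset.range (n + 1), C ((z ^ k).im) * derivative^[k] Q) hQ0 orth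
    (hd (fun k => (z ^ k).re)) (hd (fun k => (z ^ k).im)) (-z.re) (-z.im) ?_ ?_ ?_ ?_
  · simp [hz] at key
    linarith
  · rw [der (fun k => (z ^ k).re), der (fun k => (z ^ k).im)]
    have t := tele (fun k => (z ^ k).re)
    simp only [pow_zero, Complex.one_re, C_1, one_mul] at t
    refine Eq.trans ?_ t
    rw [Finset.mul_sum, Finset.mul_sum, ← Finset.sum_add_distrib, ← Finset.sum_sub_distrib]
    apply Finset.sum_congr rfl
    intro k _
    rw [pow_succ, Complex.mul_re]
    simp only [C_sub, C_mul, C_neg]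
    ring
  · rw [der (fun k => (z ^ k).re), der (fun k => (z ^ k).im)]
    have t := tele (fun k => (z ^ k).im)
    simp only [pow_zero, Complex.one_im, C_0, zero_mul] at t
    refine Eq.trans ?_ t
    rw [Finset.mul_sum, Finset.mul_sum, ← Finset.sum_add_distrib, ← Finset.sum_add_distrib]
    apply Finset.sum_congr rfl
    intro k _
    rw [pow_succ, Complex.mul_im]
    simp only [C_add, C_mul, C_neg]
    ring
  · rw [h0 (fun k => (z ^ k).re)]
    have := congrArg Complex.re hsum
    simpa [Complex.re_sum] using this
  · rw [h0 (fun k => (z ^ k).im)]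
    have := congrArg Complex.im hsum
    simpa [Complex.im_sum] using this

lemma phi_real {α β : ℝ} {n : ℕ} (hα1 : -1 < α) (hα2 : α < 1) (hβ : -1 < β) (hn : 1 ≤ n) :
    (phi α β n).Splits ∧ (phi α β n).roots.Nodup ∧ (∀ x ∈ (phi α β n).roots, x < 0) := by
  have hn' : (1:ℝ) ≤ n := by exact_mod_cast hn
  have hK : (ascPochhammer ℝ n).eval (α + 1) / (n.factorial : ℝ) ≠ 0 :=
    div_ne_zero (ascPochhammer_pos n (α + 1) (by linarith)).ne' (by positivity)
  rw [phi_eq]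
  set s : ℝ := n + α + β + 1 with hs
  have key := hb (f := ∑ k ∈ Finset.range (n + 1), C ((-1/2 : ℝ) ^ k * dco α s n k) * X ^ k)
    (E := ∑ k ∈ Finset.range (n / 2 + 1),
        C ((-1/2 : ℝ) ^ (2 * k) * dco α s n (2 * k)) * X ^ k) ?_
        (f_stable hα1 hα2 hβ hn) ?_
  · obtain ⟨k1, k2, k3⟩ := key
    refine ⟨k1.C_mul _, ?_, ?_⟩
    · rw [roots_C_mul _ hK]; exact k2
    · rw [roots_C_mul _ hK]; exact k3
  · have c1 := coeff_sum_dco (fun k => (-1/2 : ℝ) ^ k * dco α s n k) n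
      (fun j hj => by simp [dco_zero_of_lt hj])
    have c2 := coeff_sum_dco (fun k => (-1/2 : ℝ) ^ (2 * k) * dco α s n (2 * k)) (n / 2)
      (fun j hj => by simp [dco_zero_of_lt (by omega : n < 2 * j)])
    rw [← expand_eq_comp_X_pow]
    ext j
    have h2 : (2 : ℝ[X]) = C 2 := rfl
    rw [coeff_add, show (-X : ℝ[X]) = C (-1) * X by simp, comp_C_mul_X_coeff, h2, coeff_C_mul, coeff_expand (by norm_num), c1]
    split_ifs with hj
    · obtain ⟨i, rfl⟩ := hj
      rw [Nat.mul_div_cancel_left _ (by norm_num), c2]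
      simp [pow_mul]; ring
    · have : Odd j := Nat.not_even_iff_odd.1 (fun h => hj h.two_dvd)
      rw [this.neg_one_pow]; ring
  · apply le_natDegree_of_ne_zero
    rw [coeff_sum_dco (fun k => (-1/2 : ℝ) ^ k * dco α s n k) n
      (fun j hj => by simp [dco_zero_of_lt hj])]
    exact mul_ne_zero (by norm_num) (dco_ne hα1 (by rw [hs]; linarith) hn)

theorem phi_consecutive_interlacing (α β : ℝ) (n : ℕ) (hn : 4 ≤ n)
    (hα1 : -1 < α) (hα2 : α < 1) (hβ : 0 < β) :
    (∀ x ∈ (phi α β n).roots, x < 0) ∧ (∀ x ∈ (phi α β (n - 1)).roots, x < 0) ∧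
    StrictlyInterlacing (phi α β n) (phi α β (n - 1)) := by
  obtain ⟨a1, a2, a3⟩ := phi_real (n := n) hα1 hα2 (by linarith : -1 < β) (by omega)
  obtain ⟨b1, b2, b3⟩ := phi_real (n := n - 1) hα1 hα2 (by linarith : -1 < β) (by omega)
  obtain ⟨c1, c2, c3⟩ := phi_real (n := n) hα1 hα2 (by linarith : -1 < β - 1) (by omega)
  have hn' : (4:ℝ) ≤ n := by exact_mod_cast hn
  obtain ⟨m, rfl⟩ : ∃ m, n = m + 1 := ⟨n - 1, by omega⟩
  rw [Nat.add_sub_cancel] at *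
  have hK : ∀ N : ℕ, (ascPochhammer ℝ N).eval (α + 1) / (N.factorial : ℝ) ≠ 0 := fun N =>
    div_ne_zero (ascPochhammer_pos N (α + 1) (by linarith)).ne' (by positivity)
  set s : ℝ := ((m + 1 : ℕ):ℝ) + α + β with hs
  have hspos : 0 < s := by rw [hs]; linarith
  have hm : ((m + 1 : ℕ) : ℝ) = m + 1 := by push_cast; ring
  -- coefficient descriptions
  have pc : ∀ (b' : ℝ) (N j : ℕ), (phi α b' N).coeff j =
      (ascPochhammer ℝ N).eval (α + 1) / (N.factorial : ℝ) *
        ((-1/2 : ℝ) ^ (2 * j) * dco α (N + α + b' + 1) N (2 * j)) := by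
    intro b' N j
    rw [phi_eq, coeff_C_mul, coeff_sum_dco
      (fun k => (-1/2 : ℝ) ^ (2 * k) * dco α (N + α + b' + 1) N (2 * k)) (N / 2)
      (fun j hj => by simp [dco_zero_of_lt (by omega : N < 2 * j)])]
  have s1 : ((m + 1 : ℕ):ℝ) + α + (β - 1) + 1 = s := by rw [hs]; ring
  have s2 : ((m + 1 : ℕ):ℝ) + α + β + 1 = s + 1 := by rw [hs]
  have s3 : (m:ℝ) + α + β + 1 = s := by rw [hs]; push_cast; ring
  have thc : ∀ (g : ℝ[X]) (j : ℕ), (X * derivative g).coeff j = j * g.coeff j := by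
    intro g j
    rcases j with _ | j
    · simp
    · rw [coeff_X_mul, coeff_derivative]; push_cast; ring
  have hA : phi α β (m + 1) = C (1 / s) * (C s * phi α (β - 1) (m + 1) +
      C 2 * (X * derivative (phi α (β - 1) (m + 1)))) := by
    ext j
    rw [coeff_C_mul, coeff_add, coeff_C_mul, coeff_C_mul, thc, pc, pc, s1, s2]
    have h := dco_shift_s α s (m + 1) (2 * j)
    push_cast at h
    have h' : dco α (s + 1) (m + 1) (2 * j) = (s + 2 * j) * dco α s (m + 1) (2 * j) / s := by
      rw [eq_div_iff hspos.ne']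
      linear_combination -h
    rw [h']
    have e : 1 / s * s = 1 := one_div_mul_cancel hspos.ne'
    rw [div_eq_mul_one_div _ s]
    generalize 1 / s = r at e ⊢
    linear_combination (0 : ℝ) * e
  have hBK : ((m:ℝ) + 1) ≠ 0 := by positivity
  set K1 := (ascPochhammer ℝ (m + 1)).eval (α + 1) / ((m + 1).factorial : ℝ) with hK1
  set K0 := (ascPochhammer ℝ m).eval (α + 1) / (m.factorial : ℝ) with hK0
  have hB : phi α β m = C (K0 / (K1 * (m + 1))) * (C ((m:ℝ) + 1) * phi α (β - 1) (m + 1) -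
      C 2 * (X * derivative (phi α (β - 1) (m + 1)))) := by
    ext j
    rw [coeff_C_mul, coeff_sub, coeff_C_mul, coeff_C_mul, thc, pc, pc, s1, s3, ← hK1, ← hK0]
    have h := dco_shift_n α s m (2 * j)
    push_cast at h
    have := hK (m + 1)
    rw [← hK1] at this
    have h' : dco α s m (2 * j) = (m + 1 - 2 * j) * dco α s (m + 1) (2 * j) / (m + 1) := by
      rw [eq_div_iff hBK]
      linear_combination -h
    rw [h']
    clear_value K0 K1
    generalize dco α s (m + 1) (2 * j) = d
    field_simp
  have hdeg : 1 ≤ (phi α (β - 1) (m + 1)).natDegree := by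
    apply le_natDegree_of_ne_zero
    rw [pc, s1]
    exact mul_ne_zero (hK _) (mul_ne_zero (by norm_num) (dco_ne hα1 hspos (by omega)))
  have hW := wronskian_ne (a := 1 / s) (b := K0 / (K1 * (m + 1))) (s := s) (n := (m:ℝ) + 1)
    c1 c2 c3 hdeg (by positivity) (div_ne_zero (hK m) (mul_ne_zero (hK (m + 1)) hBK))
    (by positivity) hA hB
  have hW' : ∀ x : ℝ, (derivative (phi α β m)).eval x * (phi α β (m + 1)).eval x -
      (phi α β m).eval x * (derivative (phi α β (m + 1))).eval x ≠ 0 := by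
    intro x h
    apply hW x
    linear_combination -h
  refine ⟨a3, b3, ⟨splits_iff_card_roots.1 a1, a2⟩, ⟨splits_iff_card_roots.1 b1, b2⟩, ?_,
    half_interlace hW, half_interlace hW'⟩
  rintro x ⟨hx, hy⟩
  apply hW x
  rw [IsRoot.def] at hx hy
  rw [hx, hy]; ring
end

section
/- Fix n ≥ 4, −1 < α < 0, β > 0, A > 0, and let g(x;μ) := Σ_{k=0}^n μ^k [μ·(d/dx)^k P_n^{(α,β)}(x) + A·(d/dx)^k P_{n−1}^{(α,β)}(x)]. Then the polynomial μ ↦ g(1;μ) is Hurwitz stable: every complex zero μ of g(1;·) satisfies Re μ < 0. -/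
open Polynomial

/-- the Jacobi differential operator -/
noncomputable def jacT (α β : ℝ) (q : Polynomial ℝ) : Polynomial ℝ :=
  (1 - X) * (1 + X) * derivative (derivative q) +
    (C (β + 1) * (1 - X) - C (α + 1) * (1 + X)) * derivative q

/-- the variable `(1-x)/2` -/
noncomputable def jacU : Polynomial ℝ := C (1 / 2 : ℝ) * (1 - X)

lemma jacU_half : (C (1/2 : ℝ) : Polynomial ℝ) * 2 = 1 := by
  rw [← C_ofNat, ← C_mul]; norm_num

lemma jacX_eq : (X : Polynomial ℝ) = 1 - 2 * jacU := by
  unfold jacU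
  linear_combination (X - 1 : Polynomial ℝ) * (-1) * jacU_half

lemma derivative_jacU : derivative jacU = -C (1/2 : ℝ) := by
  unfold jacU; simp

lemma jacT_pow (α β : ℝ) (k : ℕ) :
    jacT α β (jacU ^ (k + 1)) =
      C (((k : ℝ) + 1) * (k + 1 + α)) * jacU ^ k
        - C (((k : ℝ) + 1) * (k + 2 + α + β)) * jacU ^ (k + 1) := by
  have h2 := jacU_half
  have hd := derivative_jacU
  unfold jacT
  rcases k with _ | k
  · simp only [zero_add, pow_one, hd, derivative_neg, derivative_C, jacX_eq, pow_zero,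
      C_mul, C_add, C_1, Nat.cast_zero, C_0, C_ofNat]
    linear_combination (-(C β + 1) * jacU + (C α + 1) * (1 - jacU)) * h2
  · simp only [derivative_pow, hd, derivative_mul, derivative_neg, derivative_C, jacX_eq,
      C_mul, C_add, C_1, Nat.cast_succ, Nat.add_sub_cancel, C_ofNat, derivative_natCast,
      derivative_add, derivative_one, map_natCast, Nat.cast_add, Nat.cast_one]
    generalize (C (1/2 : ℝ) : Polynomial ℝ) = h at *
    have hh : h * h * 4 = 1 := by linear_combination (2 * h + 1) * h2
    linear_combination
      (((k : ℝ[X]) + 2) * (k + 1) * (1 - jacU) * jacU ^ (k + 1)) * hh +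
      (((k : ℝ[X]) + 2) * jacU ^ (k + 1) *
        (-(C β + 1) * jacU + (C α + 1) * (1 - jacU))) * h2

lemma jacT_add (α β : ℝ) (p q : Polynomial ℝ) : jacT α β (p + q) = jacT α β p + jacT α β q := by
  unfold jacT; simp only [derivative_add]; ring

lemma jacT_C_mul (α β c : ℝ) (p : Polynomial ℝ) : jacT α β (C c * p) = C c * jacT α β p := by
  unfold jacT; simp only [derivative_C_mul]; ring

/-- coefficients -/
noncomputable def jacC (α β : ℝ) (n k : ℕ) : ℝ :=
  ((ascPochhammer ℝ k).eval (-(n : ℝ)) * (ascPochhammer ℝ k).eval ((n : ℝ) + α + β + 1) /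
          ((k.factorial : ℝ) * (ascPochhammer ℝ k).eval (α + 1)))

lemma jacC_succ (α β : ℝ) (n k : ℕ) (hα : -1 < α) :
    jacC α β n (k+1) * (((k : ℝ) + 1) * (k + 1 + α)) =
      jacC α β n k * (((k : ℝ) - n) * (n + α + β + 1 + k)) := by
  have h1 : 0 < (ascPochhammer ℝ k).eval (α + 1) := ascPochhammer_pos _ _ (by linarith)
  have h2 : (0 : ℝ) < k + 1 + α := by have : (0 : ℝ) ≤ k := k.cast_nonneg; linarith
  have h3 : (0 : ℝ) < α + 1 + k := by linarith
  have h4 : (0 : ℝ) < k.factorial := by positivity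
  unfold jacC
  rw [ascPochhammer_succ_eval, ascPochhammer_succ_eval, ascPochhammer_succ_eval,
    Nat.factorial_succ]
  push_cast
  field_simp
  ring

lemma jacSum_ode (α β : ℝ) (n m : ℕ) (hα : -1 < α) :
    jacT α β (∑ k ∈ Finset.range (m + 1), C (jacC α β n k) * jacU ^ k) +
      C ((n : ℝ) * (n + α + β + 1)) * (∑ k ∈ Finset.range (m + 1), C (jacC α β n k) * jacU ^ k)
      = -C (jacC α β n (m+1) * (((m : ℝ) + 1) * (m + 1 + α))) * jacU ^ m := by
  induction m with
  | zero =>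
    have := jacC_succ α β n 0 hα
    rw [this]
    simp [jacT]
    ring
  | succ m ih =>
    rw [Finset.sum_range_succ, jacT_add, jacT_C_mul, jacT_pow, mul_add]
    have h := jacC_succ α β n (m+1) hα
    rw [h]
    simp only [C_mul, C_add, C_sub, C_1, C_neg, C_ofNat, map_natCast, Nat.cast_add, Nat.cast_one] at ih ⊢
    linear_combination ih

lemma jacobiP_eq (α β : ℝ) (n : ℕ) : jacobiP α β n =
    C ((ascPochhammer ℝ n).eval (α + 1) / (n.factorial : ℝ)) *
      ∑ k ∈ Finset.range (n + 1), C (jacC α β n k) * jacU ^ k := rfl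

lemma jacobiP_ode (α β : ℝ) (n : ℕ) (hα : -1 < α) :
    jacT α β (jacobiP α β n) = -C ((n : ℝ) * (n + α + β + 1)) * jacobiP α β n := by
  have h := jacSum_ode α β n n hα
  have h0 : jacC α β n (n+1) * (((n : ℝ) + 1) * (n + 1 + α)) = 0 := by
    rw [jacC_succ _ _ _ _ hα]; simp
  rw [h0] at h
  rw [jacobiP_eq, jacT_C_mul]
  simp only [C_0, neg_zero, zero_mul] at h
  linear_combination (C ((ascPochhammer ℝ n).eval (α + 1) / (n.factorial : ℝ))) * h

lemma natDegree_jacU : natDegree jacU = 1 := by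
  have : jacU = C (-1/2 : ℝ) * X + C (1/2) := by
    unfold jacU
    rw [show (-1/2 : ℝ) = -(1/2) by norm_num, C_neg]; ring
  rw [this]; exact natDegree_linear (by norm_num)

lemma natDegree_jacU_pow (k : ℕ) : natDegree (jacU ^ k) = k := by
  rw [natDegree_pow, natDegree_jacU, mul_one]

lemma coeff_jacU_pow (k : ℕ) : (jacU ^ k).coeff k = (-1/2) ^ k := by
  have h : jacU.coeff 1 = -1/2 := by
    unfold jacU; rw [coeff_C_mul]; simp [coeff_one]; norm_num
  have := coeff_pow_of_natDegree_le (p := jacU) (m := k) (n := 1) natDegree_jacU.le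
  rw [mul_one] at this
  rw [this, h]

lemma natDegree_jacobiP_le (α β : ℝ) (n : ℕ) : natDegree (jacobiP α β n) ≤ n := by
  rw [jacobiP_eq]
  refine (natDegree_C_mul_le _ _).trans (natDegree_sum_le_of_forall_le _ _ fun k hk => ?_)
  refine (natDegree_C_mul_le _ _).trans ?_
  rw [natDegree_jacU_pow]
  have := Finset.mem_range.1 hk; omega

lemma coeff_jacobiP_pos (α β : ℝ) (n : ℕ) (hα : -1 < α) (hβ : 0 < β) :
    0 < (jacobiP α β n).coeff n := by
  rw [jacobiP_eq, coeff_C_mul, finsetSum_coeff, Finset.sum_range_succ,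
    Finset.sum_eq_zero, coeff_C_mul, coeff_jacU_pow, zero_add]
  · have h1 : 0 < (ascPochhammer ℝ n).eval (α + 1) := ascPochhammer_pos _ _ (by linarith)
    have h2 : 0 < (ascPochhammer ℝ n).eval (n + α + β + 1) :=
      ascPochhammer_pos _ _ (by have : (0 : ℝ) ≤ n := n.cast_nonneg; linarith)
    have h4 : (0 : ℝ) < n.factorial := by positivity
    have h5 : (ascPochhammer ℝ n).eval (-(n : ℝ)) = (-1) ^ n * n.factorial := by
      rw [ascPochhammer_eval_neg_eq_descPochhammer, ← Nat.cast_id n, Nat.cast_id,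
        descPochhammer_eval_eq_descFactorial, Nat.descFactorial_self]
    unfold jacC
    rw [h5]
    have h6 : ((-1 : ℝ)) ^ n * (-1/2) ^ n = (1/2) ^ n := by rw [← mul_pow]; norm_num
    have : ((-1) ^ n * (n.factorial : ℝ) * eval (↑n + α + β + 1) (ascPochhammer ℝ n) / (↑n.factorial * eval (α + 1) (ascPochhammer ℝ n)) * (-1 / 2) ^ n) =
      (1/2) ^ n * (eval (↑n + α + β + 1) (ascPochhammer ℝ n) / eval (α + 1) (ascPochhammer ℝ n)) := by
      rw [← h6]; field_simp
    rw [this]; positivity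
  · intro k hk
    rw [coeff_C_mul, coeff_eq_zero_of_natDegree_lt, mul_zero]
    rw [natDegree_jacU_pow]; exact Finset.mem_range.1 hk

/-- integration by parts property of a functional -/
def JacIBP (α β : ℝ) (L : Polynomial ℝ →ₗ[ℝ] ℝ) : Prop :=
  ∀ p : Polynomial ℝ, L ((1 - X) * (1 + X) * derivative p +
    (C β * (1 - X) - C (α + 1) * (1 + X)) * p) = 0

lemma jac_ortho_pow {α β : ℝ} {L : Polynomial ℝ →ₗ[ℝ] ℝ} (hL : JacIBP α β L)
    (hα : -1 < α) (hβ : 0 < β) (n m : ℕ) (hm : m < n) :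
    L ((1 + X) * (jacobiP α β n * jacU ^ m)) = 0 := by
  have key : ∀ q, L ((1 + X) * (jacobiP α β n * jacT α β q)) =
      - ((n : ℝ) * (n + α + β + 1)) * L ((1 + X) * (jacobiP α β n * q)) := by
    intro q
    have h := hL ((1 + X) * (derivative (jacobiP α β n) * q - jacobiP α β n * derivative q))
    have e : (1 - X) * (1 + X) * derivative ((1 + X) * (derivative (jacobiP α β n) * q - jacobiP α β n * derivative q)) +
      (C β * (1 - X) - C (α + 1) * (1 + X)) * ((1 + X) * (derivative (jacobiP α β n) * q - jacobiP α β n * derivative q))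
      = (1 + X) * (jacT α β (jacobiP α β n) * q) - (1 + X) * (jacobiP α β n * jacT α β q) := by
      unfold jacT
      simp only [derivative_mul, derivative_add, derivative_sub, derivative_one, derivative_X, C_add, C_1]
      ring
    rw [e, jacobiP_ode _ _ _ hα, map_sub, sub_eq_zero] at h
    rw [← h, show (1 + X) * (-C ((n : ℝ) * (n + α + β + 1)) * jacobiP α β n * q) =
      (- ((n : ℝ) * (n + α + β + 1))) • ((1 + X) * (jacobiP α β n * q)) by
        rw [smul_eq_C_mul, C_neg]; ring, map_smul, smul_eq_mul]
  have hn0 : (0 : ℝ) ≤ n := n.cast_nonneg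
  induction m with
  | zero =>
    have h := key 1
    have h1 : (1 : ℝ) ≤ n := by exact_mod_cast hm
    simp only [jacT, derivative_one, derivative_zero, mul_zero, add_zero, map_zero] at h
    rw [pow_zero]
    have : (n : ℝ) * (n + α + β + 1) ≠ 0 := by
      apply ne_of_gt; apply mul_pos <;> linarith
    have h2 := mul_eq_zero.1 h.symm
    rcases h2 with h2 | h2
    · exact absurd (neg_eq_zero.1 h2) this
    · exact h2
  | succ m ih =>
    have ih := ih (by omega)
    have h := key (jacU ^ (m+1))
    rw [jacT_pow] at h
    have e : (1 + X) * (jacobiP α β n * (C (((m : ℝ) + 1) * (m + 1 + α)) * jacU ^ m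
        - C (((m : ℝ) + 1) * (m + 2 + α + β)) * jacU ^ (m + 1))) =
        (((m : ℝ) + 1) * (m + 1 + α)) • ((1 + X) * (jacobiP α β n * jacU ^ m)) -
        (((m : ℝ) + 1) * (m + 2 + α + β)) • ((1 + X) * (jacobiP α β n * jacU ^ (m+1))) := by
      rw [smul_eq_C_mul, smul_eq_C_mul]; ring
    rw [e, map_sub, map_smul, map_smul, ih, smul_zero, smul_eq_mul] at h
    have hm' : (m : ℝ) + 1 < n := by exact_mod_cast hm
    have hm0 : (0 : ℝ) ≤ m := m.cast_nonneg
    have h3 : ((n : ℝ) - (m + 1)) * (n + m + 2 + α + β) * L ((1 + X) * (jacobiP α β n * jacU ^ (m+1))) = 0 := by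
      linear_combination h
    have : ((n : ℝ) - (m + 1)) * (n + m + 2 + α + β) ≠ 0 := by
      apply ne_of_gt; apply mul_pos <;> linarith
    exact (mul_eq_zero.1 h3).resolve_left this

lemma jac_ortho {α β : ℝ} {L : Polynomial ℝ →ₗ[ℝ] ℝ} (hL : JacIBP α β L)
    (hα : -1 < α) (hβ : 0 < β) (n : ℕ) (q : Polynomial ℝ) (hq : q.degree < n) :
    L ((1 + X) * (jacobiP α β n * q)) = 0 := by
  by_cases hq0 : q = 0
  · simp [hq0]
  have hqn : q.natDegree < n := (natDegree_lt_iff_degree_lt hq0).2 hq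
  set r := q.comp (1 - 2 * X) with hr
  have hrd : r.natDegree < n := by
    refine lt_of_le_of_lt natDegree_comp_le ?_
    have : natDegree (1 - 2 * X : ℝ[X]) ≤ 1 := by
      rw [← C_ofNat]; compute_degree
    nlinarith
  have hqr : q = r.comp jacU := by
    rw [hr, comp_assoc]
    simp only [sub_comp, one_comp, mul_comp, X_comp, ofNat_comp]
    rw [Nat.cast_ofNat, ← jacX_eq, comp_X]
  rw [hqr, comp, eval₂_eq_sum_range, Finset.mul_sum, Finset.mul_sum, map_sum]
  apply Finset.sum_eq_zero
  intro i hi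
  have := jac_ortho_pow hL hα hβ n i (by have := Finset.mem_range.1 hi; omega)
  rw [show (1 + X) * (jacobiP α β n * (C (r.coeff i) * jacU ^ i)) =
    (r.coeff i) • ((1 + X) * (jacobiP α β n * jacU ^ i)) by rw [smul_eq_C_mul]; ring,
    map_smul, this, smul_zero]

lemma jac_ortho_top {α β : ℝ} {L : Polynomial ℝ →ₗ[ℝ] ℝ} (hL : JacIBP α β L)
    (hα : -1 < α) (hβ : 0 < β) (n : ℕ) (q : Polynomial ℝ) (hq : q.natDegree ≤ n) :
    L ((1 + X) * (jacobiP α β n * q)) =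
      q.coeff n / (jacobiP α β n).coeff n * L ((1 + X) * (jacobiP α β n * jacobiP α β n)) := by
  set c := q.coeff n / (jacobiP α β n).coeff n with hc
  have hP := coeff_jacobiP_pos α β n hα hβ
  have h := jac_ortho hL hα hβ n (q - C c * jacobiP α β n) (by
    rw [degree_lt_iff_coeff_zero]
    intro m hm
    rw [coeff_sub, coeff_C_mul]
    rcases hm.eq_or_lt with rfl | hm
    · rw [hc]; field_simp; ring
    · rw [coeff_eq_zero_of_natDegree_lt (by omega), coeff_eq_zero_of_natDegree_lt
        (lt_of_le_of_lt (natDegree_jacobiP_le α β n) hm)]; simp)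
  rw [show (1 + X) * (jacobiP α β n * (q - C c * jacobiP α β n)) =
    (1 + X) * (jacobiP α β n * q) - c • ((1 + X) * (jacobiP α β n * jacobiP α β n)) by
      rw [smul_eq_C_mul]; ring, map_sub, map_smul, sub_eq_zero] at h
  exact h

/-- positivity of a functional -/
def JacPos (L : Polynomial ℝ →ₗ[ℝ] ℝ) : Prop :=
  ∀ p : Polynomial ℝ, p ≠ 0 → (∀ x ∈ Set.Ioo (-1 : ℝ) 1, 0 ≤ p.eval x) → 0 < L p

lemma jac_sq_nonneg {L : Polynomial ℝ →ₗ[ℝ] ℝ} (hP : JacPos L) (p : Polynomial ℝ) :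
    0 ≤ L ((1 + X) * (p * p)) := by
  by_cases hp : p = 0
  · simp [hp]
  refine (hP _ ?_ ?_).le
  · have : (1 + X : ℝ[X]) ≠ 0 := by rw [add_comm]; exact X_add_C_ne_zero (1 : ℝ)
    positivity
  · intro x hx
    simp only [eval_mul, eval_add, eval_one, eval_X]
    have := hx.1
    exact mul_nonneg (by linarith) (mul_self_nonneg _)

lemma jac_sq_pos {L : Polynomial ℝ →ₗ[ℝ] ℝ} (hP : JacPos L) (p : Polynomial ℝ) (hp : p ≠ 0) :
    0 < L ((1 + X) * (p * p)) := by
  refine (hP _ ?_ ?_)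
  · have : (1 + X : ℝ[X]) ≠ 0 := by rw [add_comm]; exact X_add_C_ne_zero (1 : ℝ)
    exact mul_ne_zero this (mul_ne_zero hp hp)
  · intro x hx
    simp only [eval_mul, eval_add, eval_one, eval_X]
    have := hx.1
    exact mul_nonneg (by linarith) (mul_self_nonneg _)

lemma jac_boundary {α β : ℝ} {L : Polynomial ℝ →ₗ[ℝ] ℝ} (hL : JacIBP α β L) (hP : JacPos L)
    (hα2 : α < 0) (hβ : 0 < β) (a : Polynomial ℝ) (ha : a ≠ 0) (ha1 : a.eval 1 = 0) :
    L ((1 + X) * (a * derivative a)) < 0 := by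
  obtain ⟨h, hh⟩ := dvd_iff_isRoot.2 (show a.IsRoot 1 from ha1)
  have hne : h ≠ 0 := by rintro rfl; simp at hh; exact ha hh
  have hfac : (C β * (1 - X) - C α * (1 + X) : ℝ[X]) ≠ 0 := by
    intro h0
    have := congrArg (eval 0) h0
    simp at this; linarith
  have h1x : (1 - X : ℝ[X]) ≠ 0 := by
    intro h0
    have := congrArg (eval 0) h0
    simp at this
  have pos := hP ((h * h) * ((1 - X) * (C β * (1 - X) - C α * (1 + X))))
    (mul_ne_zero (mul_ne_zero hne hne) (mul_ne_zero h1x hfac)) (by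
      intro x hx
      simp only [eval_mul, eval_add, eval_sub, eval_one, eval_X, eval_C]
      have h1 := hx.1
      have h2 := hx.2
      refine mul_nonneg (mul_self_nonneg _) (mul_nonneg (by linarith) ?_)
      nlinarith [mul_pos hβ (sub_pos.2 h2), mul_pos (neg_pos.2 hα2) (by linarith : 0 < 1 + x)])
  have ibp := hL ((1 - X) * (h * h))
  have e : (1 - X) * (1 + X) * derivative ((1 - X) * (h * h)) +
      (C β * (1 - X) - C (α + 1) * (1 + X)) * ((1 - X) * (h * h)) =
      (2 : ℝ) • ((1 + X) * (a * derivative a)) +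
        (h * h) * ((1 - X) * (C β * (1 - X) - C α * (1 + X))) := by
    rw [smul_eq_C_mul, hh]
    simp only [derivative_mul, derivative_sub, derivative_one, derivative_X, C_add, C_1, C_ofNat]
    ring
  rw [e, map_add, map_smul, smul_eq_mul] at ibp
  linarith

/-- the weight -/
noncomputable def jacW (α β : ℝ) (x : ℝ) : ℝ := (1 - x) ^ α * (1 + x) ^ (β - 1)

lemma jacW_integrable {α β : ℝ} (hα : -1 < α) (hβ : 0 < β) :
    IntervalIntegrable (jacW α β) MeasureTheory.volume (-1) 1 := by
  have h1 : IntervalIntegrable (fun x : ℝ => (1 + x) ^ (β - 1)) MeasureTheory.volume (-1) 0 := by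
    have := (intervalIntegral.intervalIntegrable_rpow' (a := 0) (b := 1) (r := β - 1)
      (by linarith)).comp_add_left 1
    simpa using this
  have h2 : IntervalIntegrable (fun x : ℝ => (1 - x) ^ α) MeasureTheory.volume 0 1 := by
    have := (intervalIntegral.intervalIntegrable_rpow' (a := 1) (b := 0) (r := α)
      hα).comp_sub_left 1
    simpa using this
  have i1 : IntervalIntegrable (jacW α β) MeasureTheory.volume (-1) 0 := by
    refine h1.continuousOn_mul ?_
    refine ContinuousOn.rpow_const (by fun_prop) ?_
    intro x hx
    rw [Set.uIcc_of_le (by norm_num)] at hx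
    left; have := hx.2; linarith
  have i2 : IntervalIntegrable (jacW α β) MeasureTheory.volume 0 1 := by
    refine h2.mul_continuousOn ?_
    refine ContinuousOn.rpow_const (by fun_prop) ?_
    intro x hx
    rw [Set.uIcc_of_le (by norm_num)] at hx
    left; have := hx.1; linarith
  exact i1.trans i2

lemma jacW_mul_integrable {α β : ℝ} (hα : -1 < α) (hβ : 0 < β) (p : Polynomial ℝ) :
    IntervalIntegrable (fun x => p.eval x * jacW α β x) MeasureTheory.volume (-1) 1 :=
  (jacW_integrable hα hβ).continuousOn_mul p.continuous.continuousOn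

/-- the integration functional -/
noncomputable def jacL {α β : ℝ} (hα : -1 < α) (hβ : 0 < β) : Polynomial ℝ →ₗ[ℝ] ℝ where
  toFun p := ∫ x in (-1 : ℝ)..1, p.eval x * jacW α β x
  map_add' p q := by
    rw [← intervalIntegral.integral_add (jacW_mul_integrable hα hβ p) (jacW_mul_integrable hα hβ q)]
    congr 1; ext x; rw [eval_add]; ring
  map_smul' c p := by
    rw [RingHom.id_apply, smul_eq_mul, ← intervalIntegral.integral_const_mul]
    congr 1; ext x; rw [eval_smul, smul_eq_mul]; ring

lemma jacL_ibp {α β : ℝ} (hα : -1 < α) (hβ : 0 < β) : JacIBP α β (jacL hα hβ) := by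
  intro p
  show ∫ x in (-1 : ℝ)..1, _ = _
  have := intervalIntegral.integral_eq_sub_of_hasDerivAt_of_le (a := -1) (b := 1)
    (f := fun x => ((1 - x) ^ (α + 1) * (1 + x) ^ β) * p.eval x) (by norm_num) ?_ ?_
    (jacW_mul_integrable hα hβ ((1 - X) * (1 + X) * derivative p +
      (C β * (1 - X) - C (α + 1) * (1 + X)) * p))
  · rw [this]
    have h1 : (0 : ℝ) ^ (α + 1) = 0 := Real.zero_rpow (by linarith)
    have h2 : (0 : ℝ) ^ β = 0 := Real.zero_rpow (by linarith)
    simp [h1, h2]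
  · refine ContinuousOn.mul (ContinuousOn.mul ?_ ?_) p.continuous.continuousOn
    · exact ContinuousOn.rpow_const (by fun_prop) (fun x _ => Or.inr (by linarith))
    · exact ContinuousOn.rpow_const (by fun_prop) (fun x _ => Or.inr (by linarith))
  · intro x hx
    have hx1 : 0 < 1 - x := by linarith [hx.2]
    have hx2 : 0 < 1 + x := by linarith [hx.1]
    have d1 : HasDerivAt (fun x : ℝ => (1 - x) ^ (α + 1)) (-1 * (α + 1) * (1 - x) ^ (α + 1 - 1)) x :=
      ((hasDerivAt_id x).const_sub 1).rpow_const (Or.inl hx1.ne')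
    have d2 : HasDerivAt (fun x : ℝ => (1 + x) ^ β) (1 * β * (1 + x) ^ (β - 1)) x :=
      ((hasDerivAt_id x).const_add 1).rpow_const (Or.inl hx2.ne')
    refine ((d1.mul d2).mul (p.hasDerivAt x)).congr_deriv ?_
    have e1 : (1 - x) ^ (α + 1) = (1 - x) ^ α * (1 - x) := by
      rw [Real.rpow_add hx1, Real.rpow_one]
    have e2 : (1 + x) ^ β = (1 + x) ^ (β - 1) * (1 + x) := by
      rw [← Real.rpow_add_one hx2.ne']; simp
    simp only [Pi.mul_apply]
    rw [add_sub_cancel_right, e1, e2]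
    unfold jacW
    simp only [eval_add, eval_mul, eval_sub, eval_one, eval_X, eval_C]
    ring

lemma jacL_pos {α β : ℝ} (hα : -1 < α) (hβ : 0 < β) : JacPos (jacL hα hβ) := by
  intro p hp h0
  show 0 < ∫ x in (-1 : ℝ)..1, _
  have hw : ∀ x ∈ Set.Ioo (-1 : ℝ) 1, 0 < jacW α β x := fun x hx =>
    mul_pos (Real.rpow_pos_of_pos (by linarith [hx.2]) _) (Real.rpow_pos_of_pos (by linarith [hx.1]) _)
  have hnn : ∀ᵐ x ∂(MeasureTheory.volume.restrict (Set.Ioc (-1 : ℝ) 1)), 0 ≤ p.eval x * jacW α β x := by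
    rw [← MeasureTheory.Measure.restrict_congr_set MeasureTheory.Ioo_ae_eq_Ioc]
    exact (MeasureTheory.ae_restrict_iff' measurableSet_Ioo).2
      (Filter.Eventually.of_forall fun x hx => mul_nonneg (h0 x hx) (hw x hx).le)
  rw [intervalIntegral.integral_pos_iff_support_of_nonneg_ae' ?_ (jacW_mul_integrable hα hβ p)]
  · refine ⟨by norm_num, ?_⟩
    have hsub : Set.Ioo (-1 : ℝ) 1 \ (p.roots.toFinset : Set ℝ) ⊆
        Function.support (fun x => p.eval x * jacW α β x) ∩ Set.Ioc (-1) 1 := by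
      rintro x ⟨hx, hr⟩
      refine ⟨mul_ne_zero ?_ (hw x hx).ne', hx.1, hx.2.le⟩
      intro h; apply hr; simp [hp, h]
    refine lt_of_lt_of_le ?_ (MeasureTheory.measure_mono hsub)
    rw [MeasureTheory.measure_sdiff_null (Finset.measure_zero _ _)]
    simp
  · rw [Set.uIoc_of_le (by norm_num)]; exact hnn

/-- telescoping -/
lemma jac_tele (r : ℕ → ℝ) (D : ℕ → Polynomial ℝ) (N : ℕ) :
    ∑ k ∈ Finset.range N, (C (r k) * D k - C (r (k+1)) * D (k+1)) = C (r 0) * D 0 - C (r N) * D N :=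
  Finset.sum_range_sub' (fun k => C (r k) * D k) N

lemma jac_main {α β A s t : ℝ} {m : ℕ} (hα1 : -1 < α) (hα2 : α < 0) (hβ : 0 < β) (hA : 0 < A)
    (a b : Polynomial ℝ) (had : a.natDegree ≤ m + 1) (hbd : b.natDegree ≤ m + 1)
    (ha1 : a.eval 1 = 0) (hb1 : b.eval 1 = 0)
    (e1 : a - C s * derivative a + C t * derivative b =
      C s * jacobiP α β (m+1) + C A * jacobiP α β m)
    (e2 : b - C s * derivative b - C t * derivative a = C t * jacobiP α β (m+1)) : s < 0 := by
  set P := jacobiP α β (m+1) with hP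
  set Q := jacobiP α β m with hQ
  obtain ⟨L, hL, hpos⟩ : ∃ L : Polynomial ℝ →ₗ[ℝ] ℝ, JacIBP α β L ∧ JacPos L :=
    ⟨jacL hα1 hβ, jacL_ibp hα1 hβ, jacL_pos hα1 hβ⟩
  have cP : 0 < P.coeff (m+1) := coeff_jacobiP_pos _ _ _ hα1 hβ
  have cQ : 0 < Q.coeff m := coeff_jacobiP_pos _ _ _ hα1 hβ
  have hQd : Q.natDegree ≤ m := natDegree_jacobiP_le _ _ _
  have had' : (derivative a).natDegree ≤ m := (natDegree_derivative_le a).trans (by omega)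
  have hbd' : (derivative b).natDegree ≤ m := (natDegree_derivative_le b).trans (by omega)
  have z1 : (derivative a).coeff (m+1) = 0 := coeff_eq_zero_of_natDegree_lt (by omega)
  have z2 : (derivative b).coeff (m+1) = 0 := coeff_eq_zero_of_natDegree_lt (by omega)
  have z3 : Q.coeff (m+1) = 0 := coeff_eq_zero_of_natDegree_lt (by omega)
  have ca : a.coeff (m+1) = s * P.coeff (m+1) := by
    have := congrArg (fun q => coeff q (m+1)) e1
    simpa [coeff_C_mul, z1, z2, z3] using this
  have cb : b.coeff (m+1) = t * P.coeff (m+1) := by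
    have := congrArg (fun q => coeff q (m+1)) e2
    simpa [coeff_C_mul, z1, z2, z3] using this
  have hab : a ≠ 0 ∨ b ≠ 0 := by
    by_contra! h
    obtain ⟨rfl, rfl⟩ := h
    rw [coeff_zero] at ca
    have hs : s = 0 := by
      rcases mul_eq_zero.1 ca.symm with h | h
      · exact h
      · exact absurd h cP.ne'
    have := congrArg (fun q => coeff q m) e1
    simp [hs, coeff_C_mul, hA.ne', cQ.ne'] at this
  have ba : L ((1 + X) * (a * derivative a)) ≤ 0 := by
    by_cases h : a = 0
    · simp [h]
    · exact (jac_boundary hL hpos hα2 hβ a h ha1).le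
  have bb : L ((1 + X) * (b * derivative b)) ≤ 0 := by
    by_cases h : b = 0
    · simp [h]
    · exact (jac_boundary hL hpos hα2 hβ b h hb1).le
  have bsum : L ((1 + X) * (a * derivative a)) + L ((1 + X) * (b * derivative b)) < 0 := by
    rcases hab with h | h
    · linarith [jac_boundary hL hpos hα2 hβ a h ha1]
    · linarith [jac_boundary hL hpos hα2 hβ b h hb1]
  have oa : L ((1 + X) * (P * derivative a)) = 0 := jac_ortho hL hα1 hβ (m+1) _
    (by rw [degree_lt_iff_coeff_zero]; intro k hk; exact coeff_eq_zero_of_natDegree_lt (by omega))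
  have ob : L ((1 + X) * (P * derivative b)) = 0 := jac_ortho hL hα1 hβ (m+1) _
    (by rw [degree_lt_iff_coeff_zero]; intro k hk; exact coeff_eq_zero_of_natDegree_lt (by omega))
  have qa : L ((1 + X) * (Q * derivative a)) = _ := jac_ortho_top hL hα1 hβ m _ had'
  rw [← hQ, coeff_derivative, ca] at qa
  have hQQ : 0 < L ((1 + X) * (Q * Q)) := jac_sq_pos hpos Q (by rintro h; simp [h] at cQ)
  have na := jac_sq_nonneg hpos (derivative a)
  have nb := jac_sq_nonneg hpos (derivative b)
  have E : (1 + X) * (a * derivative a) + (1 + X) * (b * derivative b) =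
      s • ((1 + X) * (derivative a * derivative a)) + s • ((1 + X) * (derivative b * derivative b)) +
      s • ((1 + X) * (P * derivative a)) + A • ((1 + X) * (Q * derivative a)) +
      t • ((1 + X) * (P * derivative b)) := by
    simp only [smul_eq_C_mul]
    linear_combination (1 + X) * derivative a * e1 + (1 + X) * derivative b * e2
  have E' := congrArg L E
  simp only [map_add, map_smul, smul_eq_mul, oa, ob, qa] at E'
  set ρ := L ((1 + X) * (Q * Q))
  have key : s * (L ((1 + X) * (derivative a * derivative a)) +
      L ((1 + X) * (derivative b * derivative b)) +
      A * (P.coeff (m+1) * (m + 1) / Q.coeff m * ρ)) < 0 := by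
    calc _ = _ := ?_
      _ < 0 := bsum
    rw [E']; ring
  have hpp : 0 < A * (P.coeff (m+1) * (m + 1) / Q.coeff m * ρ) :=
    mul_pos hA (mul_pos (div_pos (mul_pos cP (by positivity)) cQ) hQQ)
  by_contra! hs
  exact absurd key (not_lt.2 (mul_nonneg hs (by linarith)))

lemma natDegree_iterate_le (p : Polynomial ℝ) (k : ℕ) :
    (derivative^[k] p).natDegree ≤ p.natDegree :=
  (natDegree_iterate_derivative p k).trans (Nat.sub_le _ _)

/-- The polynomial `μ ↦ g(1;μ)`, where
`g(x;μ) = Σ_{k=0}^n μ^k [μ·(d/dx)^k P_n^{(α,β)}(x) + A·(d/dx)^k P_{n−1}^{(α,β)}(x)]`,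
is Hurwitz stable for `n ≥ 4`, `−1 < α < 0`, `β > 0`, `A > 0`. -/
theorem g_at_one_hurwitz_stable (α β A : ℝ) (n : ℕ) (hn : 4 ≤ n)
    (hα1 : -1 < α) (hα2 : α < 0) (hβ : 0 < β) (hA : 0 < A) :
    HurwitzStable
      (∑ k ∈ Finset.range (n + 1),
        (C ((Polynomial.derivative^[k] (jacobiP α β n)).eval 1) * X ^ (k + 1) +
          C (A * (Polynomial.derivative^[k] (jacobiP α β (n - 1))).eval 1) * X ^ k)) := by
  obtain ⟨m, rfl⟩ : ∃ m, n = m + 1 := ⟨n - 1, by omega⟩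
  rw [Nat.add_sub_cancel]
  intro z hz
  set P := jacobiP α β (m+1) with hP
  set Q := jacobiP α β m with hQ
  have hPd : P.natDegree ≤ m + 1 := natDegree_jacobiP_le _ _ _
  have hQd : Q.natDegree ≤ m := natDegree_jacobiP_le _ _ _
  have zP : derivative^[m + 1 + 1] P = 0 := iterate_derivative_eq_zero (by omega)
  have zQ : derivative^[m + 1 + 1] Q = 0 := iterate_derivative_eq_zero (by omega)
  set r : ℕ → ℝ := fun k => (z ^ k).re with hr
  set i : ℕ → ℝ := fun k => (z ^ k).im with hi
  have rs : ∀ k, r (k+1) = z.re * r k - z.im * i k := by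
    intro k; simp only [hr, hi, pow_succ, Complex.mul_re]; ring
  have is : ∀ k, i (k+1) = z.re * i k + z.im * r k := by
    intro k; simp only [hr, hi, pow_succ, Complex.mul_im]; ring
  have r0 : r 0 = 1 := by simp [hr]
  have i0 : i 0 = 0 := by simp [hi]
  -- the real and imaginary parts of `g`
  let G : (ℕ → ℝ) → Polynomial ℝ := fun f => ∑ k ∈ Finset.range (m + 1 + 1),
    (C (f (k+1)) * derivative^[k] P + C (A * f k) * derivative^[k] Q)
  have hGd : ∀ f, (G f).natDegree ≤ m + 1 := by
    intro f
    refine natDegree_sum_le_of_forall_le _ _ fun k _ => natDegree_add_le_of_degree_le ?_ ?_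
    · exact (natDegree_C_mul_le _ _).trans ((natDegree_iterate_le _ _).trans hPd)
    · exact (natDegree_C_mul_le _ _).trans ((natDegree_iterate_le _ _).trans (by omega))
  have hGder : ∀ f, derivative (G f) = ∑ k ∈ Finset.range (m + 1 + 1),
      (C (f (k+1)) * derivative^[k+1] P + C (A * f k) * derivative^[k+1] Q) := by
    intro f
    simp only [G, derivative_sum, derivative_add, derivative_C_mul, Function.iterate_succ_apply']
  have hre : (G r).eval 1 = 0 := by
    have := congrArg Complex.re hz
    rw [map_sum, Complex.re_sum] at this
    simp only [G, eval_finsetSum]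
    rw [Complex.zero_re] at this
    rw [← this]
    refine Finset.sum_congr rfl fun k _ => ?_
    simp only [map_add, map_mul, aeval_C, map_pow, aeval_X, Complex.add_re, eval_add, eval_mul, eval_C,
      Complex.coe_algebraMap, Complex.re_ofReal_mul, ← Complex.ofReal_mul, hr]
    ring
  have him : (G i).eval 1 = 0 := by
    have := congrArg Complex.im hz
    rw [map_sum, Complex.im_sum] at this
    simp only [G, eval_finsetSum]
    rw [Complex.zero_im] at this
    rw [← this]
    refine Finset.sum_congr rfl fun k _ => ?_
    simp only [map_add, map_mul, aeval_C, map_pow, aeval_X, Complex.add_im, eval_add, eval_mul, eval_C,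
      Complex.coe_algebraMap, Complex.im_ofReal_mul, ← Complex.ofReal_mul, hi]
    ring
  refine jac_main (s := z.re) (t := z.im) (m := m) hα1 hα2 hβ hA (G r) (G i) (hGd r) (hGd i) hre him ?_ ?_
  · have tP := jac_tele (fun k => r (k+1)) (fun k => derivative^[k] P) (m+1+1)
    have tQ := jac_tele (fun k => A * r k) (fun k => derivative^[k] Q) (m+1+1)
    simp only [zP, zQ, mul_zero, sub_zero, Function.iterate_zero, id, r0, mul_one] at tP tQ
    have r1 : r (0+1) = z.re := by rw [rs, r0, i0]; ring
    rw [r1] at tP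
    rw [← hP, ← hQ, ← tP, ← tQ, hGder, hGder, Finset.mul_sum, Finset.mul_sum,
      ← Finset.sum_sub_distrib, ← Finset.sum_add_distrib, ← Finset.sum_add_distrib]
    refine Finset.sum_congr rfl fun k _ => ?_
    rw [rs (k+1)]
    simp only [C_mul, C_sub]
    have := congrArg C (rs k)
    simp only [C_mul, C_sub] at this
    linear_combination (C A * derivative^[k+1] Q) * this
  · have tP := jac_tele (fun k => i (k+1)) (fun k => derivative^[k] P) (m+1+1)
    have tQ := jac_tele (fun k => A * i k) (fun k => derivative^[k] Q) (m+1+1)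
    simp only [zP, zQ, mul_zero, sub_zero, Function.iterate_zero, id, i0, C_0, zero_mul] at tP tQ
    have i1 : i (0+1) = z.im := by rw [is, r0, i0]; ring
    rw [i1] at tP
    rw [← hP, ← add_zero (C z.im * P), ← tP, ← tQ, hGder, hGder, Finset.mul_sum, Finset.mul_sum,
      ← Finset.sum_sub_distrib, ← Finset.sum_sub_distrib, ← Finset.sum_add_distrib]
    refine Finset.sum_congr rfl fun k _ => ?_
    rw [is (k+1)]
    simp only [C_mul, C_add]
    have := congrArg C (is k)
    simp only [C_mul, C_add] at this
    linear_combination (C A * derivative^[k+1] Q) * this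
end
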